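/- arXiv:1001.4170 — 4 statements merged into one kernel-verified Lean document; each statement's English description precedes it below -/
import Mathlib

section
/- The only odd positive integers n with s_2(n) = s_2(n^2) = 5 are n = 31, 79, 91, 157, and 279. -/
namespace BinaryDigitSum

/-! ### The binary digit sum -/

theorem sum_digits_two_pow_mul (k m : ℕ) :
    (Nat.digits 2 (2 ^ k * m)).sum = (Nat.digits 2 m).sum := by
  rcases Nat.eq_zero_or_pos m with rfl | hm
  · simp
  · simp [Nat.digits_base_pow_mul (b := 2) one_lt_two hm]

theorem sum_digits_one_add_two_mul (m : ℕ) :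
    (Nat.digits 2 (1 + 2 * m)).sum = (Nat.digits 2 m).sum + 1 := by
  rw [Nat.digits_add 2 one_lt_two 1 m one_lt_two (Or.inl one_ne_zero), List.sum_cons, add_comm]

theorem sum_digits_two_pow_add {k m : ℕ} (h : 2 ^ (k + 1) ∣ m) :
    (Nat.digits 2 (2 ^ k + m)).sum = (Nat.digits 2 m).sum + 1 := by
  obtain ⟨q, rfl⟩ := h
  rw [show 2 ^ k + 2 ^ (k + 1) * q = 2 ^ k * (1 + 2 * q) by ring, sum_digits_two_pow_mul,
    sum_digits_two_pow_mul, sum_digits_one_add_two_mul]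

theorem exists_lowest_digit {m k : ℕ} (h : (Nat.digits 2 m).sum = k + 1) :
    ∃ a q, m = 2 ^ a * (1 + 2 * q) ∧ (Nat.digits 2 q).sum = k := by
  have hm : m ≠ 0 := by rintro rfl; simp at h
  obtain ⟨a, r, ⟨q, rfl⟩, rfl⟩ := Nat.exists_eq_two_pow_mul_odd hm
  refine ⟨a, q, by ring, ?_⟩
  rw [sum_digits_two_pow_mul, add_comm (2 * q), sum_digits_one_add_two_mul] at h
  omega

theorem eq_zero_of_sum_digits_eq_zero {m : ℕ} (h : (Nat.digits 2 m).sum = 0) : m = 0 := by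
  by_contra hm
  obtain ⟨a, q, ⟨r, rfl⟩, rfl⟩ := Nat.exists_eq_two_pow_mul_odd hm
  rw [sum_digits_two_pow_mul, add_comm (2 * r), sum_digits_one_add_two_mul] at h
  omega

/-! ### Linear forms with natural coefficients

A linear form is the list of its coefficients. It is evaluated at `e : ℕ → ℕ`; coordinate `0`
carries the constant term, so that evaluation points of interest satisfy `e 0 = 1`. -/

def dot : List ℕ → (ℕ → ℕ) → ℕ
  | [], _ => 0
  | a :: f, e => a * e 0 + dot f (fun k => e (k + 1))

def addForm : List ℕ → List ℕ → List ℕ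
  | [], g => g
  | a :: f, [] => a :: f
  | a :: f, b :: g => (a + b) :: addForm f g

def leForm : List ℕ → List ℕ → Bool
  | [], _ => true
  | a :: f, [] => Nat.beq a 0 && leForm f []
  | a :: f, b :: g => Nat.ble a b && leForm f g

def lexLt : List ℕ → List ℕ → Bool
  | a :: f, b :: g => Nat.blt a b || (Nat.beq a b && lexLt f g)
  | _, _ => false

/-- Adds `v` to the coefficient with index `j`. -/
def addAt (v : ℕ) : ℕ → List ℕ → List ℕ
  | 0, [] => [v]
  | 0, a :: f => (a + v) :: f
  | j + 1, [] => 0 :: addAt v j []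
  | j + 1, a :: f => a :: addAt v j f

def coeff : List ℕ → ℕ → ℕ
  | [], _ => 0
  | a :: _, 0 => a
  | _ :: f, i + 1 => coeff f i

def succForm (f : List ℕ) : List ℕ := addAt 1 0 f

/-- Substitutes `x i + x j` for `x i`. -/
def shift (i j : ℕ) (f : List ℕ) : List ℕ := addAt (coeff f i) j f

/-- Substitutes `0` for `x i`. -/
def setZero : ℕ → List ℕ → List ℕ
  | _, [] => []
  | 0, _ :: f => 0 :: f
  | i + 1, a :: f => a :: setZero i f

theorem dot_addForm (f g : List ℕ) (e : ℕ → ℕ) : dot (addForm f g) e = dot f e + dot g e := by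
  induction f, g using addForm.induct generalizing e with
  | case1 g => simp [addForm, dot]
  | case2 a f => simp [addForm, dot]
  | case3 a f b g ih => simp only [addForm, dot, ih]; ring

theorem dot_le_dot {f g : List ℕ} (h : leForm f g = true) (e : ℕ → ℕ) : dot f e ≤ dot g e := by
  induction f, g using leForm.induct generalizing e with
  | case1 g => simp [dot]
  | case2 a f ih =>
    simp only [leForm, Bool.and_eq_true, Nat.beq_eq] at h
    simpa [dot, h.1] using ih h.2 _
  | case3 a f b g ih =>
    simp only [leForm, Bool.and_eq_true, Nat.ble_eq] at h
    exact Nat.add_le_add (Nat.mul_le_mul_right _ h.1) (ih h.2 _)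

theorem dot_addAt (v j : ℕ) (f : List ℕ) (e : ℕ → ℕ) :
    dot (addAt v j f) e = dot f e + v * e j := by
  induction j, f using addAt.induct generalizing e with
  | case1 => simp [addAt, dot]
  | case2 a f => simp only [addAt, dot]; ring
  | case3 j ih => simp [addAt, dot, ih]
  | case4 j a f ih => simp only [addAt, dot, ih]; ring

theorem dot_succForm (f : List ℕ) {e : ℕ → ℕ} (he : e 0 = 1) :
    dot (succForm f) e = dot f e + 1 := by
  rw [succForm, dot_addAt, he]

theorem dot_update_add (f : List ℕ) (i v : ℕ) (e : ℕ → ℕ) :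
    dot f (Function.update e i (e i + v)) = dot f e + coeff f i * v := by
  induction f generalizing i e with
  | nil => simp [dot, coeff]
  | cons a f ih =>
    cases i with
    | zero => simp [dot, coeff, Function.update]; ring
    | succ i =>
      have : (fun k => Function.update e (i + 1) (e (i + 1) + v) (k + 1)) =
          Function.update (fun k => e (k + 1)) i (e (i + 1) + v) := by
        funext k
        simp [Function.update_apply]
      simp only [dot, coeff, this, ih i (fun k => e (k + 1))]
      simp [add_assoc]

theorem dot_shift (i j : ℕ) (f : List ℕ) (e : ℕ → ℕ) :
    dot (shift i j f) e = dot f (Function.update e i (e i + e j)) := by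
  rw [shift, dot_addAt, dot_update_add]

theorem dot_setZero {i : ℕ} (f : List ℕ) {e : ℕ → ℕ} (he : e i = 0) :
    dot (setZero i f) e = dot f e := by
  induction i, f using setZero.induct generalizing e with
  | case1 => simp [setZero]
  | case2 a f => simp [setZero, dot, he]
  | case3 i a f ih => 
    simp only [setZero, dot]
    rw [ih (e := fun k => e (k + 1)) he]

/-! ### Sums of powers of two with linear exponents -/

def powSum (L : List (List ℕ)) (e : ℕ → ℕ) : ℕ :=
  (L.map fun f => 2 ^ dot f e).sum

@[simp] theorem powSum_nil (e : ℕ → ℕ) : powSum [] e = 0 := rfl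

@[simp] theorem powSum_cons (f : List ℕ) (L : List (List ℕ)) (e : ℕ → ℕ) :
    powSum (f :: L) e = 2 ^ dot f e + powSum L e := by
  simp [powSum]

theorem powSum_append (L M : List (List ℕ)) (e : ℕ → ℕ) :
    powSum (L ++ M) e = powSum L e + powSum M e := by
  simp [powSum]

theorem powSum_map {g : List ℕ → List ℕ} {e e' : ℕ → ℕ} (h : ∀ f, dot (g f) e' = dot f e)
    (L : List (List ℕ)) : powSum (L.map g) e' = powSum L e := by
  simp [powSum, Function.comp_def, h]

theorem dvd_powSum {k : ℕ} {L : List (List ℕ)} {e : ℕ → ℕ} (h : ∀ f ∈ L, k ≤ dot f e) :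
    2 ^ k ∣ powSum L e := by
  induction L with
  | nil => simp
  | cons f L ih =>
    rw [powSum_cons]
    exact dvd_add (pow_dvd_pow 2 (h f (by simp))) (ih fun g hg => h g (by simp [hg]))

/-- The expansion of the square of a sum of powers of two. -/
def squareTerms : List (List ℕ) → List (List ℕ)
  | [] => []
  | f :: L => addForm f f :: (L.map (fun g => succForm (addForm f g)) ++ squareTerms L)

theorem powSum_squareTerms (L : List (List ℕ)) {e : ℕ → ℕ} (he : e 0 = 1) :
    powSum (squareTerms L) e = powSum L e ^ 2 := by
  induction L with
  | nil => simp [squareTerms]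
  | cons f L ih =>
    have h : powSum (L.map (fun g => succForm (addForm f g))) e
        = 2 * 2 ^ dot f e * powSum L e := by
      clear ih
      induction L with
      | nil => simp
      | cons g L ihL =>
        rw [List.map_cons, powSum_cons, powSum_cons, ihL, dot_succForm _ he, dot_addForm]
        ring
    rw [squareTerms, powSum_cons, powSum_append, h, ih, powSum_cons, dot_addForm]
    ring

/-- Splits off the lexicographically smallest form. -/
def popMin : List ℕ → List (List ℕ) → List ℕ × List (List ℕ)
  | t, [] => (t, [])
  | t, u :: L =>
    if lexLt u t then ((popMin u L).1, t :: (popMin u L).2)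
    else ((popMin t L).1, u :: (popMin t L).2)

theorem popMin_spec (t : List ℕ) (L : List (List ℕ)) (e : ℕ → ℕ) :
    2 ^ dot (popMin t L).1 e + powSum (popMin t L).2 e = 2 ^ dot t e + powSum L e := by
  induction L generalizing t with
  | nil => simp [popMin]
  | cons u L ih =>
    rw [popMin]
    split_ifs
    · have := ih u
      simp only [powSum_cons]
      omega
    · have := ih t
      simp only [powSum_cons]
      omega

def eraseForm (t : List ℕ) : List (List ℕ) → Option (List (List ℕ))
  | [] => none
  | u :: L => if leForm t u && leForm u t then some L else (eraseForm t L).map (u :: ·)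

theorem powSum_eraseForm {t : List ℕ} {L M : List (List ℕ)} (h : eraseForm t L = some M)
    (e : ℕ → ℕ) : powSum L e = 2 ^ dot t e + powSum M e := by
  induction L generalizing M with
  | nil => simp [eraseForm] at h
  | cons u L ih =>
    rw [eraseForm] at h
    split_ifs at h with hu
    · rw [Bool.and_eq_true] at hu
      obtain rfl : L = M := by simpa using h
      rw [powSum_cons, le_antisymm (dot_le_dot hu.1 e) (dot_le_dot hu.2 e)]
    · obtain ⟨N, hN, rfl⟩ := Option.map_eq_some_iff.1 h
      rw [powSum_cons, powSum_cons, ih hN]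
      omega

/-! ### The decision procedure -/

/-- The first index at which the coefficient of the first form is smaller, counting from `k`. -/
def firstLt (k : ℕ) : List ℕ → List ℕ → Option ℕ
  | a :: f, b :: g => if Nat.blt a b then some k else firstLt (k + 1) f g
  | _, _ => none

/-- The two variables to compare in order to make progress on comparing two forms; the index `0`
stands for the constant `0`. -/
def splitVars (t u : List ℕ) : ℕ × ℕ :=
  match firstLt 1 u.tail t.tail, firstLt 1 t.tail u.tail with
  | some i, some j => (i, j)
  | some i, none => (i, 0)
  | none, some j => (j, 0)
  | none, none => (0, 0)

/-- Checks that all forms in `L` are constant and that `powSum L` lies in `S`. -/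
def constIn (S : List ℕ) (L : List (List ℕ)) : Bool :=
  L.all (fun f => leForm f [coeff f 0]) && S.elem ((L.map fun f => 2 ^ coeff f 0).sum)

/-- Checks, with fuel, that the binary digit sum of `powSum L` is `r` only where `powSum E` lies in
`S`. Equal smallest exponents are merged, a smallest exponent that is strictly below all others
contributes one digit, and incomparable exponents cause a case distinction on the variables. -/
def check (S : List ℕ) : ℕ → ℕ → List (List ℕ) → List (List ℕ) → Bool
  | 0, _, _, _ => false
  | _ + 1, r, [], E => !Nat.beq r 0 || constIn S E
  | _ + 1, 0, _ :: _, _ => true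
  | n + 1, r + 1, t :: L, E =>
    match popMin t L with
    | (m, M) =>
      match eraseForm m M with
      | some N => check S n (r + 1) (succForm m :: N) E
      | none =>
        match M.find? (fun u => !leForm (succForm m) u) with
        | none => check S n r M E
        | some u =>
          match splitVars m u with
          | (0, _) => false
          | (i + 1, 0) =>
            check S n (r + 1) ((t :: L).map (setZero (i + 1))) (E.map (setZero (i + 1))) &&
            check S n (r + 1) ((t :: L).map (shift (i + 1) 0)) (E.map (shift (i + 1) 0))
          | (i + 1, j + 1) =>
            !Nat.beq i j &&
            check S n (r + 1) ((t :: L).map (shift (i + 1) (j + 1)))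
              (E.map (shift (i + 1) (j + 1))) &&
            check S n (r + 1) ((t :: L).map (shift (j + 1) (i + 1)))
              (E.map (shift (j + 1) (i + 1)))

theorem powSum_mem_of_constIn {S : List ℕ} {L : List (List ℕ)} (h : constIn S L = true)
    {e : ℕ → ℕ} (he : e 0 = 1) : powSum L e ∈ S := by
  simp only [constIn, Bool.and_eq_true, List.all_eq_true, List.elem_iff] at h
  have hdot : ∀ f ∈ L, dot f e = coeff f 0 := by
    intro f hf
    refine le_antisymm (by simpa [dot, he] using dot_le_dot (h.1 f hf) e) ?_
    cases f <;> simp [dot, coeff, he]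
  have hsum : powSum L e = (L.map fun f => 2 ^ coeff f 0).sum := by
    rw [powSum]
    congr 1
    exact List.map_congr_left fun f hf => by rw [hdot f hf]
  exact hsum ▸ h.2

theorem check_sound {S : List ℕ} {n r : ℕ} {L E : List (List ℕ)} (h : check S n r L E = true)
    {e : ℕ → ℕ} (he : e 0 = 1) (hr : (Nat.digits 2 (powSum L e)).sum = r) :
    powSum E e ∈ S := by
  induction n generalizing r L E e with
  | zero => simp [check] at h
  | succ n ih =>
    have hshift : ∀ {i j : ℕ}, i + 1 ≠ j → e j ≤ e (i + 1) →
        check S n r (L.map (shift (i + 1) j)) (E.map (shift (i + 1) j)) = true →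
        powSum E e ∈ S := by
      intro i j hij hle hc
      have hdot : ∀ f, dot (shift (i + 1) j f)
          (Function.update e (i + 1) (e (i + 1) - e j)) = dot f e := by
        intro f
        rw [dot_shift]
        congr 1
        simp [Function.update_of_ne hij.symm, Nat.sub_add_cancel hle]
      rw [← powSum_map hdot]
      refine ih hc (by simpa using he) ?_
      rwa [powSum_map hdot]
    match r, L with
    | r, [] =>
      obtain rfl : r = 0 := by simpa using hr.symm
      exact powSum_mem_of_constIn (by simpa [check] using h) he
    | 0, t :: L =>
      have := eq_zero_of_sum_digits_eq_zero hr
      simp at this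
    | r + 1, t :: L =>
      have hpop := popMin_spec t L e
      rw [check] at h
      split at h
      next m M hmM =>
      simp only [hmM] at hpop
      split at h
      next N hN =>
        refine ih h he ?_
        rw [← hr, powSum_cons, powSum_cons, ← hpop, powSum_eraseForm hN, dot_succForm _ he]
        congr 2
        ring
      next =>
      split at h
      next hfind =>
        refine ih h he ?_
        rw [powSum_cons, ← hpop, sum_digits_two_pow_add] at hr
        · omega
        · refine dvd_powSum fun u hu => ?_
          rw [← dot_succForm _ he]
          refine dot_le_dot ?_ e
          simpa using List.find?_eq_none.1 hfind u hu
      next u _ =>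
      split at h
      · simp at h
      next i _ =>
        rw [Bool.and_eq_true] at h
        rcases Nat.eq_zero_or_pos (e (i + 1)) with h0 | h0
        · rw [← powSum_map fun f => dot_setZero f h0]
          refine ih h.1 he ?_
          rwa [powSum_map fun f => dot_setZero f h0]
        · exact hshift (Nat.succ_ne_zero i) (by rw [he]; exact h0) h.2
      next i j _ =>
        simp only [Bool.and_eq_true, Bool.not_eq_true'] at h
        have hij : i + 1 ≠ j + 1 := by
          intro hij
          simp [Nat.succ_injective hij] at h
        rcases le_total (e (j + 1)) (e (i + 1)) with hle | hle
        · exact hshift hij hle h.1.2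
        · exact hshift hij.symm hle h.2

/-- The exponents of the binary digits `1` of an odd number with digit sum five, in terms of the
numbers of zeros between consecutive ones. -/
def fiveExponents : List (List ℕ) :=
  [[0, 0, 0, 0, 0], [1, 1, 0, 0, 0], [2, 1, 1, 0, 0], [3, 1, 1, 1, 0], [4, 1, 1, 1, 1]]

theorem exists_powSum_fiveExponents {n : ℕ} (hodd : Odd n) (h : (Nat.digits 2 n).sum = 5) :
    ∃ e : ℕ → ℕ, e 0 = 1 ∧ n = powSum fiveExponents e := by
  obtain ⟨m, rfl⟩ := hodd
  rw [add_comm, sum_digits_one_add_two_mul] at h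
  replace h : (Nat.digits 2 m).sum = 4 := by omega
  obtain ⟨a, q₁, rfl, h₁⟩ := exists_lowest_digit h
  obtain ⟨b, q₂, rfl, h₂⟩ := exists_lowest_digit h₁
  obtain ⟨c, q₃, rfl, h₃⟩ := exists_lowest_digit h₂
  obtain ⟨d, q₄, rfl, h₄⟩ := exists_lowest_digit h₃
  obtain rfl := eq_zero_of_sum_digits_eq_zero h₄
  refine ⟨fun k => [1, a, b, c, d].getD k 0, rfl, ?_⟩
  simp [powSum, fiveExponents, dot]
  ring

theorem check_fiveExponents :
    check [31, 79, 91, 157, 279] 100 5 (squareTerms fiveExponents) fiveExponents = true := by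
  decide +kernel

end BinaryDigitSum

open BinaryDigitSum in
theorem odd_k5_classification (n : ℕ) (hn : 0 < n) (hodd : Odd n) :
    ((Nat.digits 2 n).sum = 5 ∧ (Nat.digits 2 (n ^ 2)).sum = 5) ↔
      n = 31 ∨ n = 79 ∨ n = 91 ∨ n = 157 ∨ n = 279 := by
  constructor
  · rintro ⟨h, hsq⟩
    obtain ⟨e, he, rfl⟩ := exists_powSum_fiveExponents hodd h
    rw [← powSum_squareTerms _ he] at hsq
    simpa using check_sound check_fiveExponents he hsq
  · rintro (rfl | rfl | rfl | rfl | rfl) <;> norm_num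
end

section
/- Let q ≥ 3 and k ≥ 94(q−1) be integers. Then the equation s_q(n^2) = s_q(n) = k has infinitely many solutions n with q ∤ n if and only if k(k − 1) ≡ 0 (mod q − 1). -/
theorem digits_sum_eq_mod_add {q : ℕ} (hq : 1 < q) (n : ℕ) :
    (Nat.digits q n).sum = n % q + (Nat.digits q (n / q)).sum := by
  rcases Nat.eq_zero_or_pos n with rfl | hn
  · simp
  · rw [Nat.digits_def' hq hn, List.sum_cons]

theorem digits_sum_add_pow_mul {q : ℕ} (hq : 1 < q) (m : ℕ) :
    ∀ {a : ℕ} (b : ℕ), a < q ^ m → (Nat.digits q (a + q ^ m * b)).sum =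
      (Nat.digits q a).sum + (Nat.digits q b).sum := by
  induction m with
  | zero =>
    intro a b h
    obtain rfl : a = 0 := by simpa using h
    simp
  | succ m ih =>
    intro a b h
    have h1 : a + q ^ (m + 1) * b = a + q * (q ^ m * b) := by ring
    have h2 : a / q < q ^ m := Nat.div_lt_of_lt_mul (by rwa [← pow_succ'])
    rw [digits_sum_eq_mod_add hq (a + q ^ (m + 1) * b), digits_sum_eq_mod_add hq a, h1,
      Nat.add_mul_mod_self_left, Nat.add_mul_div_left _ _ (by omega), ih b h2, add_assoc]

theorem digits_sum_add_digits_sum_of_add_one_eq_pow {q : ℕ} (hq : 1 < q) (m : ℕ) :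
    ∀ {a b : ℕ}, a + b + 1 = q ^ m →
      (Nat.digits q a).sum + (Nat.digits q b).sum = (q - 1) * m := by
  induction m with
  | zero =>
    intro a b h
    obtain ⟨rfl, rfl⟩ : a = 0 ∧ b = 0 := by simp at h; omega
    simp
  | succ m ih =>
    intro a b h
    rw [digits_sum_eq_mod_add hq a, digits_sum_eq_mod_add hq b]
    have ha := Nat.mod_add_div a q
    have hb := Nat.mod_add_div b q
    have ha' := Nat.mod_lt a (by omega : 0 < q)
    have hb' := Nat.mod_lt b (by omega : 0 < q)
    set r := a % q
    set r' := b % q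
    have key : (r + r' + 1) + q * (a / q + b / q) = q * q ^ m := by
      rw [← pow_succ']; linarith
    have hdvd : q ∣ r + r' + 1 :=
      (Nat.dvd_add_left (dvd_mul_right q _)).1 (key ▸ dvd_mul_right q _)
    obtain ⟨c, hc⟩ := hdvd
    have hc1 : c = 1 := by
      have : c < 2 := by
        by_contra! h2
        nlinarith
      have : c ≠ 0 := by rintro rfl; omega
      omega
    subst hc1
    have h3 : a / q + b / q + 1 = q ^ m := by
      apply Nat.eq_of_mul_eq_mul_left (by omega : 0 < q)
      rw [← key, hc]; ring
    have := ih h3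
    rw [mul_add]
    omega

theorem digits_sum_le_of_lt_pow {q : ℕ} (hq : 1 < q) {m n : ℕ} (h : n < q ^ m) :
    (Nat.digits q n).sum ≤ (q - 1) * m := by
  have := digits_sum_add_digits_sum_of_add_one_eq_pow hq m
    (a := n) (b := q ^ m - 1 - n) (by omega)
  omega

theorem digits_sum_of_add_eq_mul_pow {q : ℕ} (hq : 1 < q) {m a b c : ℕ} (ha : 0 < a)
    (hc : 0 < c) (hcm : c ≤ q ^ m) (h : b + c = a * q ^ m) :
    (Nat.digits q b).sum + (Nat.digits q (c - 1)).sum =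
      (Nat.digits q (a - 1)).sum + (q - 1) * m := by
  obtain ⟨a, rfl⟩ := Nat.exists_eq_succ_of_ne_zero ha.ne'
  have h1 : b = (q ^ m - c) + q ^ m * a := by
    rw [Nat.succ_eq_add_one, add_mul, one_mul, mul_comm] at h
    omega
  have h2 := digits_sum_add_digits_sum_of_add_one_eq_pow hq m
    (a := q ^ m - c) (b := c - 1) (by omega)
  rw [h1, digits_sum_add_pow_mul hq m a (by omega)]
  simp only [Nat.succ_eq_add_one, Nat.add_sub_cancel]
  omega

theorem digits_sum_modEq {q : ℕ} (hq : 3 ≤ q) (n : ℕ) :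
    n ≡ (Nat.digits q n).sum [MOD q - 1] := by
  apply Nat.modEq_digits_sum
  obtain ⟨r, rfl⟩ := Nat.exists_eq_add_of_le hq
  rw [show 3 + r = (3 + r - 1) + 1 by omega, Nat.add_sub_cancel, Nat.add_mod_left]
  exact Nat.mod_eq_of_lt (by omega)

theorem digits_sum_pos (q : ℕ) {n : ℕ} (hn : 0 < n) : 0 < (Nat.digits q n).sum := by
  by_contra! h
  have h0 : ∀ d ∈ Nat.digits q n, d = 0 := List.sum_eq_zero_iff.1 (by omega)
  exact Nat.getLast_digit_ne_zero q hn.ne' (h0 _ (List.getLast_mem _))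

theorem le_digits_sum_of_dvd {q n : ℕ} (hq : 3 ≤ q) (hn : 0 < n) (h : q - 1 ∣ n) :
    q - 1 ≤ (Nat.digits q n).sum :=
  Nat.le_of_dvd (digits_sum_pos q hn) (((digits_sum_modEq hq n).dvd_iff dvd_rfl).1 h)

/-- With `x = q ^ t`, this is `1 + 2 x - x ^ 2 + 2 x ^ 3 + x ^ 4`: its square has
nonnegative coefficients. -/
def lowBlock (q t : ℕ) : ℕ :=
  1 + q ^ t * (2 + q ^ t * ((2 * q ^ t - 1) + q ^ (2 * t) * 1))

/-- The polynomial `(q - 1) + v q ^ p + (q - 1) x ^ 2` in `x = q ^ (p + s)`. -/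
def highBlock (q v p s : ℕ) : ℕ :=
  (q - 1) + q ^ p * (v + q ^ (p + 2 * s) * (q - 1))

theorem digits_sum_lowBlock {q t : ℕ} (hq : 3 ≤ q) (ht : 3 ≤ t) :
    (Nat.digits q (lowBlock q t)).sum = 5 + (q - 1) * t := by
  have h1 : 1 < q := by omega
  have hx : 27 ≤ q ^ t := (Nat.pow_le_pow_left hq 3).trans (Nat.pow_le_pow_right (by omega) ht)
  have hC := digits_sum_of_add_eq_mul_pow h1 (m := t) (a := 2) (b := 2 * q ^ t - 1) (c := 1)
    (by omega) (by omega) (by omega) (by omega)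
  rw [lowBlock, digits_sum_add_pow_mul h1 t _ (by omega),
    digits_sum_add_pow_mul h1 t _ (by omega),
    digits_sum_add_pow_mul h1 (2 * t) _ (by
      rw [two_mul t, pow_add]; nlinarith [Nat.sub_le (2 * q ^ t) 1])]
  have e1 : (Nat.digits q 1).sum = 1 := by
    rw [Nat.digits_of_lt q 1 (by omega) (by omega), List.sum_singleton]
  have e2 : (Nat.digits q 2).sum = 2 := by
    rw [Nat.digits_of_lt q 2 (by omega) (by omega), List.sum_singleton]
  simp [e1, e2] at hC ⊢
  omega

theorem digits_sum_highBlock {q v p s : ℕ} (hq : 3 ≤ q) (hv : v < q) (hp : 1 ≤ p) :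
    (Nat.digits q (highBlock q v p s)).sum = 2 * (q - 1) + v := by
  have h1 : 1 < q := by omega
  have hY : q ≤ q ^ p := Nat.le_self_pow (by omega) q
  have hZ : q ≤ q ^ (p + 2 * s) := Nat.le_self_pow (by omega) q
  rw [highBlock, digits_sum_add_pow_mul h1 p _ (by omega),
    digits_sum_add_pow_mul h1 _ _ (by omega)]
  have e1 : ∀ a < q, (Nat.digits q a).sum = a := by
    intro a ha
    rcases Nat.eq_zero_or_pos a with rfl | h
    · simp
    · rw [Nat.digits_of_lt q a h.ne' ha, List.sum_singleton]
  rw [e1 _ hv, e1 (q - 1) (by omega)]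
  ring

theorem lowBlock_sq {q t : ℕ} (hq : 3 ≤ q) : lowBlock q t ^ 2 =
    1 + q ^ t * (4 + q ^ t * (2 + q ^ (2 * t) * (11 + q ^ (2 * t) *
      (2 + q ^ t * (4 + q ^ t * 1))))) := by
  have hx : 1 ≤ q ^ t := Nat.one_le_pow _ _ (by omega)
  have h2 : 1 ≤ 2 * q ^ t := by omega
  rw [lowBlock, two_mul t, pow_add]
  zify [h2]
  ring

theorem highBlock_sq {q v p s : ℕ} : highBlock q v p s ^ 2 =
    (q - 1) ^ 2 + q ^ p * (2 * (q - 1) * v + q ^ p * (v ^ 2 + q ^ (2 * s) *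
      (2 * (q - 1) ^ 2 + q ^ p * (2 * (q - 1) * v + q ^ (p + 2 * s) * (q - 1) ^ 2)))) := by
  rw [highBlock, two_mul s]
  simp only [pow_add]
  ring

theorem two_mul_lowBlock_mul_highBlock {q v p s : ℕ} (hq : 3 ≤ q)
    (hv : 2 * v ≤ 8 * (q - 1) * q ^ s) :
    2 * lowBlock q (p + s) * highBlock q v p s =
    2 * (q - 1) + q ^ p * (2 * v + q ^ s * (4 * (q - 1) + q ^ p * (4 * v + q ^ (p + s) *
      ((8 * (q - 1) * q ^ s - 2 * v) + q ^ (p + s) * (4 * v + q ^ (p + s) *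
        (2 * v + q ^ s * (4 * (q - 1) + q ^ (p + s) * (2 * (q - 1))))))))) := by
  have hx : 1 ≤ q ^ (p + s) := Nat.one_le_pow _ _ (by omega)
  have h2 : 1 ≤ 2 * q ^ (p + s) := by omega
  rw [lowBlock, highBlock]
  generalize q - 1 = w at *
  zify [h2, hv]
  rw [two_mul, two_mul (s : ℕ)]
  simp only [pow_add]
  ring

/-- The part of `s_q (n ^ 2)` that does not depend on the positions of the terms. -/
def coeffDigitsSum (q v : ℕ) : ℕ :=
  let f := fun n => (Nat.digits q n).sum
  (f 1 + f 4 + f 2 + f 11 + f 2 + f 4 + f 1) +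
  (f ((q - 1) ^ 2) + f (2 * (q - 1) * v) + f (v ^ 2) + f (2 * (q - 1) ^ 2) +
    f (2 * (q - 1) * v) + f ((q - 1) ^ 2)) +
  (f (2 * (q - 1)) + f (2 * v) + f (4 * (q - 1)) + f (4 * v) + f (8 * (q - 1) - 1) +
    f (4 * v) + f (2 * v) + f (4 * (q - 1)) + f (2 * (q - 1)))

theorem coeff_lt_cube {q v : ℕ} (hq : 3 ≤ q) (hv : v < q) :
    11 < q ^ 3 ∧ (q - 1) ^ 2 < q ^ 3 ∧ 2 * (q - 1) * v < q ^ 3 ∧ v ^ 2 < q ^ 3 ∧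
    2 * (q - 1) ^ 2 < q ^ 3 ∧ 8 * (q - 1) < q ^ 3 ∧ 4 * v < q ^ 3 := by
  obtain ⟨w, rfl⟩ : ∃ w, q = w + 1 := ⟨q - 1, by omega⟩
  have hw : 2 ≤ w := by omega
  have hv' : v ≤ w := by omega
  have h2 : v * v ≤ w * w := Nat.mul_le_mul hv' hv'
  have h3 : w * v ≤ w * w := Nat.mul_le_mul le_rfl hv'
  have h4 : 2 * w ≤ w * w := Nat.mul_le_mul hw le_rfl
  have h5 : 2 * (w * w) ≤ w * (w * w) := Nat.mul_le_mul hw le_rfl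
  have h6 : (w + 1) ^ 3 = w * (w * w) + 3 * (w * w) + 3 * w + 1 := by ring
  simp only [Nat.add_sub_cancel]
  refine ⟨?_, ?_, ?_, ?_, ?_, ?_, ?_⟩ <;> nlinarith

theorem coeffDigitsSum_le {q v : ℕ} (hq : 3 ≤ q) (hv : v < q) :
    coeffDigitsSum q v ≤ 58 * (q - 1) := by
  obtain ⟨-, h2, h3, h4, h5, h6, h7⟩ := coeff_lt_cube hq hv
  have b : ∀ n, n < q ^ 3 → (Nat.digits q n).sum ≤ (q - 1) * 3 :=
    fun n h => digits_sum_le_of_lt_pow (by omega) h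
  have := Nat.digit_sum_le q 1
  have := Nat.digit_sum_le q 4
  have := Nat.digit_sum_le q 2
  have := Nat.digit_sum_le q 11
  have := b _ h2
  have := b _ h3
  have := b _ h4
  have := b _ h5
  have := b (2 * (q - 1)) (by omega)
  have := b (4 * (q - 1)) (by omega)
  have := b (8 * (q - 1) - 1) (by omega)
  have := b (2 * v) (by omega)
  have := b (4 * v) h7
  simp only [coeffDigitsSum]
  omega

theorem le_coeffDigitsSum {q v : ℕ} (hq : 3 ≤ q) (hv : 0 < v) :
    9 * (q - 1) + 7 ≤ coeffDigitsSum q v := by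
  have hw : 0 < q - 1 := by omega
  have b : ∀ n, 0 < n → q - 1 ∣ n → q - 1 ≤ (Nat.digits q n).sum :=
    fun n => le_digits_sum_of_dvd hq
  have := digits_sum_pos q (n := 1) (by omega)
  have := digits_sum_pos q (n := 4) (by omega)
  have := digits_sum_pos q (n := 2) (by omega)
  have := digits_sum_pos q (n := 11) (by omega)
  have := b ((q - 1) ^ 2) (by positivity) (dvd_pow_self _ two_ne_zero)
  have := b (2 * (q - 1) * v) (by positivity) ((dvd_mul_left _ _).mul_right _)
  have := b (2 * (q - 1) ^ 2) (by positivity) ((dvd_pow_self _ two_ne_zero).mul_left _)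
  have := b (2 * (q - 1)) (by positivity) (dvd_mul_left _ _)
  have := b (4 * (q - 1)) (by positivity) (dvd_mul_left _ _)
  simp only [coeffDigitsSum]
  omega

theorem add_pow_mul_lt {q m a b M : ℕ} (ha : a < q ^ m) (hb : b < q ^ M) :
    a + q ^ m * b < q ^ (m + M) := by
  rw [pow_add]
  nlinarith

theorem digits_sum_sq {q v p s m : ℕ} (hq : 3 ≤ q) (hv0 : 0 < v) (hv : v < q) (hp : 3 ≤ p)
    (hs : 3 ≤ s) (hm : 8 * (p + s) + 3 ≤ m) :
    (Nat.digits q (lowBlock q (p + s) + q ^ m * highBlock q v p s)).sum =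
      5 + 2 * (q - 1) + v + (q - 1) * (p + s) ∧
    (Nat.digits q ((lowBlock q (p + s) + q ^ m * highBlock q v p s) ^ 2)).sum +
      (Nat.digits q (2 * v - 1)).sum = coeffDigitsSum q v + (q - 1) * s := by
  have h1 : 1 < q := by omega
  obtain ⟨c1, c2, c3, c4, c5, c6, c7⟩ := coeff_lt_cube hq hv
  have mono : ∀ {a i : ℕ}, 3 ≤ i → a < q ^ 3 → a < q ^ i :=
    fun hi ha => ha.trans_le (Nat.pow_le_pow_right (by omega) hi)
  have hqs : q ^ 3 ≤ q ^ s := Nat.pow_le_pow_right (by omega) hs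
  have hvs : 2 * v ≤ 8 * (q - 1) * q ^ s := by
    have : 1 * q ^ s ≤ 8 * (q - 1) * q ^ s := Nat.mul_le_mul (by omega) le_rfl
    omega
  have hB : 8 * (q - 1) * q ^ s - 2 * v < q ^ (p + s) := by
    have : 8 * (q - 1) * q ^ s < q ^ p * q ^ s :=
      Nat.mul_lt_mul_of_pos_right (mono hp c6) (by omega)
    rw [pow_add]
    omega
  have hBsum := digits_sum_of_add_eq_mul_pow h1 (m := s) (a := 8 * (q - 1))
    (b := 8 * (q - 1) * q ^ s - 2 * v) (c := 2 * v) (by omega) (by omega) (by omega) (by omega)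
  have hU2lt : lowBlock q (p + s) ^ 2 < q ^ m := by
    rw [lowBlock_sq hq]
    refine (add_pow_mul_lt (mono (by omega) (by omega)) <| add_pow_mul_lt (mono (by omega)
      (by omega)) <| add_pow_mul_lt (mono (by omega) (by omega)) <| add_pow_mul_lt
      (mono (by omega) (by omega)) <| add_pow_mul_lt (mono (by omega) (by omega)) <|
      add_pow_mul_lt (M := 3) (mono (by omega) (by omega)) (by omega)).trans_le
      (Nat.pow_le_pow_right (by omega) (by omega))
  have hUlt : lowBlock q (p + s) < q ^ m :=
    (Nat.le_self_pow two_ne_zero _).trans_lt hU2lt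
  have hUVlt : 2 * lowBlock q (p + s) * highBlock q v p s < q ^ m := by
    rw [two_mul_lowBlock_mul_highBlock hq hvs]
    refine (add_pow_mul_lt (mono (by omega) (by omega)) <| add_pow_mul_lt (mono (by omega)
      (by omega)) <| add_pow_mul_lt (mono (by omega) (by omega)) <| add_pow_mul_lt
      (mono (by omega) (by omega)) <| add_pow_mul_lt hB <| add_pow_mul_lt
      (mono (by omega) (by omega)) <| add_pow_mul_lt
      (mono (by omega) (by omega)) <|
      add_pow_mul_lt (M := 3) (mono (by omega) (by omega)) (by omega)).trans_le
      (Nat.pow_le_pow_right (by omega) (by omega))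
  constructor
  · rw [digits_sum_add_pow_mul h1 m _ hUlt, digits_sum_lowBlock hq (by omega),
      digits_sum_highBlock hq hv (by omega)]
    ring
  · have hsq : (lowBlock q (p + s) + q ^ m * highBlock q v p s) ^ 2 =
        lowBlock q (p + s) ^ 2 + q ^ m * (2 * lowBlock q (p + s) * highBlock q v p s +
          q ^ m * highBlock q v p s ^ 2) := by ring
    rw [hsq, digits_sum_add_pow_mul h1 m _ hU2lt, digits_sum_add_pow_mul h1 m _ hUVlt,
      lowBlock_sq hq, highBlock_sq, two_mul_lowBlock_mul_highBlock hq hvs]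
    have key : ∀ {a i : ℕ} (b : ℕ), 3 ≤ i → a < q ^ 3 →
        (Nat.digits q (a + q ^ i * b)).sum = (Nat.digits q a).sum + (Nat.digits q b).sum :=
      fun b hi ha => digits_sum_add_pow_mul h1 _ b (mono hi ha)
    iterate 6 rw [key _ (by omega) (by omega)]
    iterate 4 rw [key _ (by omega) (by omega)]
    rw [digits_sum_add_pow_mul h1 _ _ hB]
    iterate 3 rw [key _ (by omega) (by omega)]
    iterate 5 rw [key _ (by omega) (by assumption)]
    simp only [coeffDigitsSum]
    omega

theorem gen_q_squares (q k : ℕ) (hq : 3 ≤ q) (hk : 94 * (q - 1) ≤ k) :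
    {n : ℕ | ¬ q ∣ n ∧ (Nat.digits q (n ^ 2)).sum = k ∧
      (Nat.digits q n).sum = k}.Infinite ↔ (q - 1) ∣ k * (k - 1) := by
  have hk1 : k * (k - 1) = k ^ 2 - k := by rw [Nat.mul_sub, mul_one, sq]
  have hdvd : (q - 1) ∣ k * (k - 1) ↔ k ≡ k ^ 2 [MOD q - 1] := by
    rw [hk1, Nat.modEq_iff_dvd' (Nat.le_self_pow two_ne_zero k)]
  rw [hdvd]
  constructor
  · intro h
    obtain ⟨n, -, h1, h2⟩ := h.nonempty
    have a1 := digits_sum_modEq hq (n ^ 2)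
    have a2 := digits_sum_modEq hq n
    rw [h1] at a1
    rw [h2] at a2
    exact a1.symm.trans (a2.pow 2)
  · intro h
    have hw : 0 < q - 1 := by omega
    set v := (k - 6) % (q - 1) + 1 with hv
    set t := (k - 6) / (q - 1) - 2 with ht
    have hv0 : 0 < v := by omega
    have hmod := Nat.mod_lt (k - 6) hw
    have hvq : v < q := by omega
    have hdiv := Nat.mod_add_div (k - 6) (q - 1)
    have hdiv2 : 2 ≤ (k - 6) / (q - 1) := (Nat.le_div_iff_mul_le hw).2 (by omega)
    have hkt : k = 5 + 2 * (q - 1) + v + (q - 1) * t := by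
      rw [show (k - 6) / (q - 1) = t + 2 by omega, mul_add] at hdiv
      omega
    have hD1 := coeffDigitsSum_le hq hvq
    have hD2 := le_coeffDigitsSum hq hv0
    have hE : (Nat.digits q (2 * v - 1)).sum ≤ (q - 1) * 2 :=
      digits_sum_le_of_lt_pow (by omega) (by nlinarith [Nat.sub_le (2 * v) 1])
    have hcong : coeffDigitsSum q v ≡ k + (Nat.digits q (2 * v - 1)).sum [MOD q - 1] := by
      obtain ⟨a1, a2⟩ := digits_sum_sq hq hv0 hvq (le_refl 3) (le_refl 3) le_rfl
      have b1 := digits_sum_modEq hq (lowBlock q (3 + 3) + q ^ (8 * (3 + 3) + 3) *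
        highBlock q v 3 3)
      have b2 := digits_sum_modEq hq ((lowBlock q (3 + 3) + q ^ (8 * (3 + 3) + 3) *
        highBlock q v 3 3) ^ 2)
      rw [a1] at b1
      have b3 : 5 + 2 * (q - 1) + v + (q - 1) * (3 + 3) ≡ k [MOD q - 1] := by
        rw [hkt]
        have hz (c : ℕ) : (q - 1) * c ≡ 0 [MOD q - 1] :=
          Nat.modEq_zero_iff_dvd.2 (dvd_mul_right _ _)
        exact Nat.ModEq.add_left _ ((hz _).trans (hz _).symm)
      have b4 := (b2.symm.trans ((b1.trans b3).pow 2)).trans h.symm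
      have b5 := b4.add_right (Nat.digits q (2 * v - 1)).sum
      rw [a2] at b5
      refine Nat.ModEq.trans ?_ b5
      simp [Nat.ModEq]
    set D := coeffDigitsSum q v
    set E := (Nat.digits q (2 * v - 1)).sum
    obtain ⟨s, hs⟩ := (Nat.modEq_iff_dvd' (by omega : D ≤ k + E)).1 hcong
    have hs' : k + E = D + (q - 1) * s := by omega
    have hs3 : 3 ≤ s := by
      by_contra! hlt
      have : (q - 1) * s ≤ (q - 1) * 3 := Nat.mul_le_mul le_rfl hlt.le
      omega
    have hst : s + 3 ≤ t := by
      by_contra! hlt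
      have : (q - 1) * t ≤ (q - 1) * (s + 3) := Nat.mul_le_mul le_rfl hlt.le
      rw [mul_add] at this
      omega
    obtain ⟨p, hp⟩ : ∃ p, t = p + s := ⟨t - s, by omega⟩
    rw [hp] at hkt
    refine Set.infinite_of_forall_exists_gt fun N => ?_
    obtain ⟨a1, a2⟩ := digits_sum_sq hq hv0 hvq (by omega : 3 ≤ p) hs3
      (Nat.le_add_left (8 * (p + s) + 3) N)
    refine ⟨_, ⟨?_, ?_, a1.trans hkt.symm⟩, ?_⟩
    · rw [lowBlock, add_assoc]
      have hdv : q ∣ q ^ (p + s) := dvd_pow_self q (by omega)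
      have hdv' : q ∣ q ^ (N + (8 * (p + s) + 3)) := dvd_pow_self q (by omega)
      rw [Nat.dvd_add_left ((hdv.mul_right _).add (hdv'.mul_right _)), Nat.dvd_one]
      omega
    · change _ + E = _ at a2
      omega
    · have h1 : N + (8 * (p + s) + 3) < q ^ (N + (8 * (p + s) + 3)) :=
        Nat.lt_pow_self (by omega)
      have h2 : 1 ≤ highBlock q v p s := by
        rw [highBlock]
        omega
      have h3 := Nat.mul_le_mul (le_refl (q ^ (N + (8 * (p + s) + 3)))) h2
      omega
end

section
/- The number of positive integers n < N with s_2(n^2) = s_2(n) is ≫ N^{1/19}, i.e., there exist a constant c > 0 and N_0 such that for all N ≥ N_0, #{n < N : s_2(n^2) = s_2(n)} ≥ c·N^{1/19}. -/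
/-- The binary sum-of-digits function. -/
def binaryDigitSum (n : ℕ) : ℕ := (Nat.digits 2 n).sum

namespace binaryDigitSum

lemma two_mul_add (n e : ℕ) (he : e < 2) :
    binaryDigitSum (2 * n + e) = binaryDigitSum n + e := by
  unfold binaryDigitSum
  rcases Nat.eq_zero_or_pos (2 * n + e) with h | h
  · obtain ⟨rfl, rfl⟩ : n = 0 ∧ e = 0 := by omega
    simp
  · rw [Nat.digits_def' (by norm_num) h, List.sum_cons, show (2 * n + e) % 2 = e by omega,
      show (2 * n + e) / 2 = n by omega, add_comm]

lemma zero : binaryDigitSum 0 = 0 := by simp [binaryDigitSum]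

lemma one : binaryDigitSum 1 = 1 := by simp [binaryDigitSum]

lemma pos {n : ℕ} (hn : 0 < n) : 0 < binaryDigitSum n := by
  induction n using Nat.strong_induction_on with
  | _ n ih =>
    have h := two_mul_add (n / 2) (n % 2) (Nat.mod_lt _ two_pos)
    rw [Nat.div_add_mod] at h
    rcases Nat.eq_zero_or_pos (n / 2) with h0 | h0
    · omega
    · have := ih (n / 2) (by omega) h0
      omega

lemma two_pow_mul_add (m u v : ℕ) (hv : v < 2 ^ m) :
    binaryDigitSum (2 ^ m * u + v) = binaryDigitSum u + binaryDigitSum v := by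
  induction m generalizing v with
  | zero =>
    obtain rfl : v = 0 := by simpa using hv
    simp [zero]
  | succ m ih =>
    have he : v % 2 < 2 := Nat.mod_lt _ two_pos
    have hv' : v / 2 < 2 ^ m := by rw [pow_succ] at hv; omega
    have h1 : 2 ^ (m + 1) * u + v = 2 * (2 ^ m * u + v / 2) + v % 2 := by
      rw [pow_succ, mul_right_comm]; omega
    have h2 := two_mul_add (v / 2) (v % 2) he
    rw [Nat.div_add_mod] at h2
    rw [h1, two_mul_add _ _ he, ih _ hv', h2, add_assoc]

lemma add_of_add_one_eq_two_pow (m v w : ℕ) (h : v + w + 1 = 2 ^ m) :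
    binaryDigitSum v + binaryDigitSum w = m := by
  induction m generalizing v w with
  | zero =>
    obtain ⟨rfl, rfl⟩ : v = 0 ∧ w = 0 := by simpa using h
    simp [zero]
  | succ m ih =>
    rw [pow_succ] at h
    have hv := two_mul_add (v / 2) (v % 2) (Nat.mod_lt _ two_pos)
    have hw := two_mul_add (w / 2) (w % 2) (Nat.mod_lt _ two_pos)
    rw [Nat.div_add_mod] at hv hw
    have := ih (v / 2) (w / 2) (by omega)
    omega

lemma le_of_lt_two_pow {m v : ℕ} (hv : v < 2 ^ m) : binaryDigitSum v ≤ m := by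
  have := add_of_add_one_eq_two_pow m v (2 ^ m - 1 - v) (by omega)
  omega

/-- The digit sum of `2 ^ m * (x + 1) - (b + 1)`. -/
lemma of_add_eq_two_pow_mul (m n b x : ℕ) (hb : b < 2 ^ m)
    (h : n + (b + 1) = 2 ^ m * (x + 1)) :
    binaryDigitSum n + binaryDigitSum b = binaryDigitSum x + m := by
  obtain ⟨c, hc⟩ : ∃ c, b + c + 1 = 2 ^ m := ⟨2 ^ m - 1 - b, by omega⟩
  have hn : n = 2 ^ m * x + c := by rw [mul_add_one] at h; omega
  have := add_of_add_one_eq_two_pow m b c hc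
  rw [hn, two_pow_mul_add m x c (by omega)]
  omega

/-- The digit sum of the square of `2 ^ (p + 1) * (x + 1) - (b + 1)`. -/
lemma sq_of_add_eq_two_pow_mul (p n b x : ℕ) (hb : (b + 1) ^ 2 < 2 ^ (p + 2))
    (hxb : (x + 1) * (b + 1) ≤ 2 ^ p) (h : n + (b + 1) = 2 ^ (p + 1) * (x + 1)) :
    binaryDigitSum (n ^ 2) + binaryDigitSum ((x + 1) * (b + 1) - 1) =
      binaryDigitSum ((b + 1) ^ 2) + binaryDigitSum ((x + 1) ^ 2 - 1) + p := by
  have hle : (x + 1) * (b + 1) ≤ 2 ^ p * (x + 1) ^ 2 :=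
    hxb.trans (Nat.le_mul_of_pos_right _ (by positivity))
  obtain ⟨y, hy⟩ := Nat.exists_eq_add_of_le' hle
  have hn : n ^ 2 = 2 ^ (p + 2) * y + (b + 1) ^ 2 := by
    zify at h hy ⊢
    have hn' : (n : ℤ) = 2 ^ (p + 1) * (x + 1) - (b + 1) := by linarith
    have hy' : (y : ℤ) = 2 ^ p * (x + 1) ^ 2 - (x + 1) * (b + 1) := by linarith
    rw [hn', hy']
    ring
  have h1 : 0 < (x + 1) * (b + 1) := by positivity
  have h2 : 0 < (x + 1) ^ 2 := by positivity
  have := of_add_eq_two_pow_mul p y ((x + 1) * (b + 1) - 1) ((x + 1) ^ 2 - 1) (by omega)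
    (by rw [Nat.sub_add_cancel h1, Nat.sub_add_cancel h2, hy])
  rw [hn, two_pow_mul_add _ _ _ hb]
  omega

/-- If `n = 2 ^ (p + 1) * (2 ^ k - 1) - a` with `k = s(a ^ 2) + s(a) - 1` and `p` large, then
`n` and `n ^ 2` have the same digit sum. -/
lemma sq_eq_of_add_eq_two_pow_mul (p k a n : ℕ) (ha : 0 < a) (hak : a < 2 ^ k)
    (hk : k + 1 = binaryDigitSum (a ^ 2) + binaryDigitSum a) (hp : (2 ^ k - 1) * a ≤ 2 ^ p)
    (hap : a ^ 2 < 2 ^ (p + 2)) (h : n + a = 2 ^ (p + 1) * (2 ^ k - 1)) :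
    binaryDigitSum (n ^ 2) = binaryDigitSum n := by
  obtain ⟨b, rfl⟩ := Nat.exists_eq_add_one.mpr ha
  obtain ⟨j, rfl⟩ : ∃ j, k = j + 1 := Nat.exists_eq_add_one.mpr <|
    Nat.pos_of_ne_zero (by rintro rfl; simp at hak)
  have hj : 0 < 2 ^ j := by positivity
  obtain ⟨x, hx⟩ : ∃ x, 2 ^ (j + 1) - 1 = x + 1 := ⟨2 ^ (j + 1) - 2, by rw [pow_succ]; omega⟩
  have hx' : x + 2 = 2 ^ (j + 1) := by omega
  rw [hx] at hp h
  have hbp : b < 2 ^ (p + 1) := by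
    have : b + 1 ≤ (x + 1) * (b + 1) := Nat.le_mul_of_pos_left _ (by positivity)
    rw [pow_succ]
    omega
  have hsq := sq_of_add_eq_two_pow_mul p n b x hap hp h
  have hlin := of_add_eq_two_pow_mul (p + 1) n b x hbp h
  have hx1 : binaryDigitSum x + 1 = j + 1 := by
    simpa [one] using add_of_add_one_eq_two_pow (j + 1) x 1 hx'
  have hxx : binaryDigitSum ((x + 1) ^ 2 - 1) = j := by
    have : (x + 1) ^ 2 - 1 = 2 ^ (j + 1) * x + 0 := by
      rw [← hx', Nat.sub_eq_iff_eq_add (by nlinarith)]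
      ring
    rw [this, two_pow_mul_add _ _ _ (by positivity), zero]
    omega
  have hxb := of_add_eq_two_pow_mul (j + 1) ((x + 1) * (b + 1) - 1) (b + 1) b hak (by
    rw [← hx']
    have : 0 < (x + 1) * (b + 1) := by positivity
    zify [this]
    ring)
  omega

/-- Every number `b + 1 ≤ 2 ^ t` is encoded in the low digits of some `n < 2 ^ (14 * t + 4)` having the
same digit sum as its square. -/
lemma exists_sq_eq (t b : ℕ) (hb : b < 2 ^ t) :
    ∃ n, 0 < n ∧ n < 2 ^ (14 * t + 4) ∧ binaryDigitSum (n ^ 2) = binaryDigitSum n ∧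
      (n + 2 ^ (2 * t + 1)) % 2 ^ (8 * t + 3) = b + 1 := by
  have hbm : b + 1 ≤ 2 ^ (2 * t) :=
    hb.trans_le (Nat.pow_le_pow_right two_pos (by omega))
  have hm : 2 ^ (2 * t + 1) = 2 * 2 ^ (2 * t) := pow_succ' _ _
  obtain ⟨a, ha⟩ : ∃ a, a + (b + 1) = 2 ^ (2 * t + 1) * (0 + 1) :=
    ⟨2 ^ (2 * t + 1) - (b + 1), by omega⟩
  have hb2 : (b + 1) ^ 2 ≤ 2 ^ (2 * t) := by
    rw [mul_comm, pow_mul]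
    exact Nat.pow_le_pow_left hb 2
  have hb2' : (b + 1) ^ 2 < 2 ^ (2 * t + 1) := by omega
  have hb2'' : (b + 1) ^ 2 < 2 ^ (2 * t + 2) :=
    hb2'.trans (Nat.pow_lt_pow_right one_lt_two (by omega))
  have hsq := sq_of_add_eq_two_pow_mul (2 * t) a b 0 hb2'' (by simpa using hbm) ha
  have hlin := of_add_eq_two_pow_mul (2 * t + 1) a b 0 (by omega) ha
  simp only [zero_add, one_mul, one_pow, Nat.sub_self, zero, Nat.add_sub_cancel] at hsq hlin
  have h1 := le_of_lt_two_pow hb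
  have h2 := le_of_lt_two_pow hb2'
  have h3 : 0 < binaryDigitSum ((b + 1) ^ 2) := pos (by positivity)
  obtain ⟨k, hk⟩ : ∃ k, k + 1 = binaryDigitSum (a ^ 2) + binaryDigitSum a :=
    ⟨binaryDigitSum (a ^ 2) + binaryDigitSum a - 1, by omega⟩
  have hk1 : 2 * t + 1 ≤ k := by omega
  have hk2 : k ≤ 6 * t + 1 := by omega
  have ham : a < 2 ^ (2 * t + 1) := by omega
  have hak : a < 2 ^ k := ham.trans_le (Nat.pow_le_pow_right two_pos hk1)
  have hp : (2 ^ k - 1) * a ≤ 2 ^ (8 * t + 2) := by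
    calc (2 ^ k - 1) * a ≤ 2 ^ (6 * t + 1) * 2 ^ (2 * t + 1) :=
          Nat.mul_le_mul ((Nat.sub_le _ _).trans (Nat.pow_le_pow_right two_pos hk2)) ham.le
      _ = 2 ^ (8 * t + 2) := by rw [← pow_add]; congr 1; omega
  have hap : a ^ 2 < 2 ^ (8 * t + 2 + 2) := by
    calc a ^ 2 < (2 ^ (2 * t + 1)) ^ 2 := Nat.pow_lt_pow_left ham two_ne_zero
      _ ≤ 2 ^ (8 * t + 2 + 2) := by
        rw [← pow_mul]
        exact Nat.pow_le_pow_right two_pos (by omega)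
  have hr : 2 ^ (2 * t + 1) < 2 ^ (8 * t + 3) := Nat.pow_lt_pow_right one_lt_two (by omega)
  have hk0 : 2 ^ 1 ≤ 2 ^ k := Nat.pow_le_pow_right two_pos (by omega)
  have hle : 2 ^ (8 * t + 3) ≤ 2 ^ (8 * t + 3) * (2 ^ k - 1) :=
    Nat.le_mul_of_pos_right _ (by omega)
  obtain ⟨n, hn⟩ : ∃ n, n + a = 2 ^ (8 * t + 3) * (2 ^ k - 1) :=
    ⟨2 ^ (8 * t + 3) * (2 ^ k - 1) - a, by omega⟩
  refine ⟨n, by omega, ?_,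
    sq_eq_of_add_eq_two_pow_mul (8 * t + 2) k a n (by omega) hak hk hp hap hn, ?_⟩
  · calc n ≤ 2 ^ (8 * t + 3) * (2 ^ k - 1) := by omega
      _ < 2 ^ (8 * t + 3) * 2 ^ k := Nat.mul_lt_mul_of_pos_left (by omega) (by positivity)
      _ = 2 ^ (8 * t + 3 + k) := (pow_add _ _ _).symm
      _ ≤ 2 ^ (14 * t + 4) := Nat.pow_le_pow_right two_pos (by omega)
  · rw [show n + 2 ^ (2 * t + 1) = 2 ^ (8 * t + 3) * (2 ^ k - 1) + (b + 1) by omega,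
      Nat.mul_add_mod, Nat.mod_eq_of_lt (by omega)]

lemma two_pow_le_card (t N : ℕ) (hN : 2 ^ (14 * t + 4) ≤ N) :
    2 ^ t ≤ ((Finset.range N).filter (fun n => 0 < n ∧
      (Nat.digits 2 (n ^ 2)).sum = (Nat.digits 2 n).sum)).card := by
  choose! f hf using exists_sq_eq t
  rw [← Finset.card_range (2 ^ t)]
  refine Finset.card_le_card_of_injOn f (fun b hb => ?_) (fun b hb c hc hbc => ?_)
  · obtain ⟨h1, h2, h3, -⟩ := hf b (by simpa using hb)
    simpa using ⟨h2.trans_le hN, h1, h3⟩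
  · have h1 := (hf b (by simpa using hb)).2.2.2
    have h2 := (hf c (by simpa using hc)).2.2.2
    rw [hbc] at h1
    omega

end binaryDigitSum

theorem melfi_improved :
    ∃ c : ℝ, 0 < c ∧ ∃ N₀ : ℕ, ∀ N : ℕ, N₀ ≤ N →
      c * (N : ℝ) ^ ((1 : ℝ) / 19) ≤
        ((Finset.range N).filter (fun n => 0 < n ∧
          (Nat.digits 2 (n ^ 2)).sum = (Nat.digits 2 n).sum)).card := by
  refine ⟨1 / 2, by norm_num, 2 ^ 19, fun N hN => ?_⟩
  have hN0 : N ≠ 0 := by rintro rfl; simp at hN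
  set t := Nat.log 2 N / 19
  have hlog : 19 ≤ Nat.log 2 N := Nat.le_log_of_pow_le one_lt_two hN
  have hlower : 2 ^ (14 * t + 4) ≤ N :=
    (Nat.pow_le_pow_right two_pos (by omega)).trans (Nat.pow_log_le_self 2 hN0)
  have hupper : N ≤ (2 ^ (t + 1)) ^ 19 := by
    rw [← pow_mul]
    exact (Nat.lt_pow_succ_log_self one_lt_two N).le.trans
      (Nat.pow_le_pow_right two_pos (by omega))
  have hroot : (N : ℝ) ^ ((1 : ℝ) / 19) ≤ 2 ^ (t + 1) := by
    rw [one_div, Real.rpow_inv_le_iff_of_pos (by positivity) (by positivity) (by norm_num)]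
    exact_mod_cast hupper
  have hhalf : 1 / 2 * (N : ℝ) ^ ((1 : ℝ) / 19) ≤ 2 ^ t := by
    rw [pow_succ] at hroot
    linarith
  exact hhalf.trans (by exact_mod_cast binaryDigitSum.two_pow_le_card t N hlower)
end

section
/- Let q ≥ 2 and let p(x) ∈ ℤ[x] have degree at least 2 and positive leading coefficient. Then there exists γ > 0 (depending only on q and p) and a constant c > 0 such that for all sufficiently large N, the number of n < N with q ∤ n and |s_q(p(n)) − s_q(n)| ≤ (q−1)/2 is at least c·N^γ. -/
namespace SumOfDigits

open Polynomial

/-- The base-`q` sum of digits. -/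
def digitSum (q n : ℕ) : ℕ := (Nat.digits q n).sum

theorem digitSum_zero (q : ℕ) : digitSum q 0 = 0 := by simp [digitSum]

theorem digitSum_add_mul {q : ℕ} (hq : 2 ≤ q) {a : ℕ} (ha : a < q) (b : ℕ) :
    digitSum q (a + q * b) = a + digitSum q b := by
  unfold digitSum
  by_cases h : a = 0 ∧ b = 0
  · simp [h.1, h.2]
  · rw [Nat.digits_add q hq a b ha (by tauto)]
    simp

theorem digitSum_add_pow_mul {q : ℕ} (hq : 2 ≤ q) (k : ℕ) :
    ∀ {a : ℕ}, a < q ^ k → ∀ b, digitSum q (a + q ^ k * b) = digitSum q a + digitSum q b := by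
  induction k with
  | zero =>
    intro a ha b
    obtain rfl : a = 0 := by simpa using ha
    simp [digitSum_zero]
  | succ k ih =>
    intro a ha b
    have h1 : a % q < q := Nat.mod_lt _ (by omega)
    have h2 : a / q < q ^ k := Nat.div_lt_of_lt_mul (by rwa [pow_succ'] at ha)
    have h3 : a + q ^ (k + 1) * b = a % q + q * (a / q + q ^ k * b) := by
      conv_lhs => rw [← Nat.mod_add_div a q]
      ring
    rw [h3, digitSum_add_mul hq h1, ih h2]
    conv_rhs => rw [← Nat.mod_add_div a q, digitSum_add_mul hq h1]
    ring

theorem digitSum_compl {q : ℕ} (hq : 2 ≤ q) (k : ℕ) :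
    ∀ {a : ℕ}, a < q ^ k → digitSum q (q ^ k - 1 - a) + digitSum q a = (q - 1) * k := by
  induction k with
  | zero =>
    intro a ha
    obtain rfl : a = 0 := by simpa using ha
    simp [digitSum_zero]
  | succ k ih =>
    intro a ha
    have h1 : a % q < q := Nat.mod_lt _ (by omega)
    have h2 : a / q < q ^ k := Nat.div_lt_of_lt_mul (by rwa [pow_succ'] at ha)
    have h3 : q ^ (k + 1) - 1 - a = (q - 1 - a % q) + q * (q ^ k - 1 - a / q) := by
      obtain ⟨e, he⟩ := Nat.exists_eq_add_of_lt h2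
      obtain ⟨f, hf⟩ := Nat.exists_eq_add_of_lt h1
      have h4 : a = a % q + q * (a / q) := (Nat.mod_add_div a q).symm
      have h5 : q ^ k - 1 - a / q = e := by omega
      have h6 : q - 1 - a % q = f := by omega
      have h7 : q ^ (k + 1) = a + f + q * e + 1 := by
        rw [pow_succ', he]
        calc q * (a / q + e + 1) = q * (a / q) + q * e + q := by ring
          _ = _ := by omega
      rw [h5, h6]
      omega
    have h8 := ih h2
    have h9 : digitSum q a = a % q + digitSum q (a / q) := by
      conv_lhs => rw [← Nat.mod_add_div a q, digitSum_add_mul hq h1]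
    rw [h3, digitSum_add_mul hq (by omega), h9, mul_add, ← h8]
    omega

theorem digitSum_le {q : ℕ} (hq : 2 ≤ q) {k a : ℕ} (ha : a < q ^ k) :
    digitSum q a ≤ (q - 1) * k := by
  have := digitSum_compl hq k ha
  omega

theorem digitSum_pow_sub_one {q : ℕ} (hq : 2 ≤ q) (k : ℕ) :
    digitSum q (q ^ k - 1) = (q - 1) * k := by
  have := digitSum_compl hq k (a := 0) (by positivity)
  simpa [digitSum_zero] using this

theorem digitSum_mul_pow_sub_one {q : ℕ} (hq : 2 ≤ q) {k w : ℕ} (h1 : 1 ≤ w) (hw : w ≤ q ^ k) :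
    digitSum q (w * (q ^ k - 1)) = (q - 1) * k := by
  obtain ⟨v, rfl⟩ : ∃ v, w = v + 1 := ⟨w - 1, by omega⟩
  have h : (v + 1) * (q ^ k - 1) = (q ^ k - 1 - v) + q ^ k * v := by
    obtain ⟨e, he⟩ := Nat.exists_eq_add_of_lt (show v < q ^ k by omega)
    have h5 : q ^ k - 1 - v = e := by omega
    have h6 : q ^ k - 1 = v + e := by omega
    rw [h5, h6, he]
    ring
  rw [h, digitSum_add_pow_mul hq k (by omega), digitSum_compl hq k (by omega)]

theorem digitSum_sum {q : ℕ} (hq : 2 ≤ q) (k : ℕ) (K : ℕ) :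
    ∀ f : ℕ → ℕ, (∀ i, f i < q ^ k) →
      digitSum q (∑ i ∈ Finset.range K, f i * (q ^ k) ^ i) =
        ∑ i ∈ Finset.range K, digitSum q (f i) := by
  induction K with
  | zero => intro f _; simp [digitSum_zero]
  | succ K ih =>
    intro f hf
    have h : ∑ i ∈ Finset.range (K + 1), f i * (q ^ k) ^ i =
        f 0 + q ^ k * ∑ i ∈ Finset.range K, f (i + 1) * (q ^ k) ^ i := by
      rw [Finset.sum_range_succ', Finset.mul_sum, add_comm]
      congr 1
      · simp
      · refine Finset.sum_congr rfl fun i _ => ?_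
        ring
    rw [h, digitSum_add_pow_mul hq k (hf 0), ih _ (fun i => hf (i + 1)),
      Finset.sum_range_succ', add_comm]

theorem digitSum_eval {q : ℕ} (hq : 2 ≤ q) {k K : ℕ} {Q : ℕ[X]} (hQ : ∀ i, Q.coeff i < q ^ k)
    (hK : Q.natDegree < K) :
    digitSum q (Q.eval (q ^ k)) = ∑ i ∈ Finset.range K, digitSum q (Q.coeff i) := by
  rw [eval_eq_sum_range' hK, digitSum_sum hq k K _ hQ]

theorem sum_mul_pow_lt {q : ℕ} (K : ℕ) :
    ∀ f : ℕ → ℕ, (∀ i, f i < q) → 1 ≤ q → ∑ i ∈ Finset.range K, f i * q ^ i < q ^ K := by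
  induction K with
  | zero => simp
  | succ K ih =>
    intro f hf hq
    rw [Finset.sum_range_succ]
    have h1 := ih f hf hq
    have h2 : (f K + 1) * q ^ K ≤ q * q ^ K := Nat.mul_le_mul_right _ (hf K)
    rw [pow_succ']
    linarith

theorem coeff_le_eval_one (Q : ℕ[X]) (i : ℕ) : Q.coeff i ≤ Q.eval 1 := by
  rw [eval_eq_sum_range' (Nat.lt_succ_of_le (le_max_left Q.natDegree i))]
  simp only [one_pow, mul_one]
  refine Finset.single_le_sum (f := fun i => Q.coeff i) (fun _ _ => Nat.zero_le _) ?_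
  simp

theorem mem_lifts_iff {P : ℤ[X]} :
    P ∈ lifts (Nat.castRingHom ℤ) ↔ ∀ i, 0 ≤ P.coeff i := by
  rw [lifts_iff_coeff_lifts]
  refine forall_congr' fun i => ?_
  constructor
  · rintro ⟨a, ha⟩
    rw [← ha]; simp
  · intro h
    exact ⟨(P.coeff i).toNat, by simp [h]⟩

theorem C_mem_lifts {a : ℤ} (ha : 0 ≤ a) : C a ∈ lifts (Nat.castRingHom ℤ) := by
  rw [mem_lifts_iff]
  intro i
  rw [coeff_C]
  split_ifs <;> simp [ha]

theorem X_mem_lifts' : (X : ℤ[X]) ∈ lifts (Nat.castRingHom ℤ) := X_mem_lifts _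

/-- Every power of `T` times `1 + X`, and every power of `T` other than the first, has nonnegative
coefficients. -/
structure AlmostNonneg (T : ℤ[X]) : Prop where
  one_add_X_mul : (1 + X) * T ∈ lifts (Nat.castRingHom ℤ)
  sq : T ^ 2 ∈ lifts (Nat.castRingHom ℤ)
  cube : T ^ 3 ∈ lifts (Nat.castRingHom ℤ)

theorem one_add_X_mem : (1 + X : ℤ[X]) ∈ lifts (Nat.castRingHom ℤ) :=
  add_mem (one_mem _) X_mem_lifts'

theorem AlmostNonneg.pow {T : ℤ[X]} (hT : AlmostNonneg T) (i : ℕ) :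
    T ^ (i + 2) ∈ lifts (Nat.castRingHom ℤ) := by
  induction i using Nat.twoStepInduction with
  | zero => exact hT.sq
  | one => exact hT.cube
  | more i h1 _ =>
    have := mul_mem h1 hT.sq
    rwa [← pow_add] at this

theorem AlmostNonneg.one_add_X_mul_pow {T : ℤ[X]} (hT : AlmostNonneg T) (i : ℕ) :
    (1 + X) * T ^ i ∈ lifts (Nat.castRingHom ℤ) := by
  match i with
  | 0 => simpa using one_add_X_mem
  | 1 => simpa using hT.one_add_X_mul
  | i + 2 => exact mul_mem one_add_X_mem (hT.pow i)

theorem AlmostNonneg.add_one_add_X_mul {T V : ℤ[X]} (hT : AlmostNonneg T)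
    (hV : V ∈ lifts (Nat.castRingHom ℤ)) : AlmostNonneg (T + (1 + X) * V) := by
  have hZ := mul_mem one_add_X_mem hV
  have hTZ := mul_mem hT.one_add_X_mul hV
  constructor
  · have : (1 + X) * (T + (1 + X) * V) = (1 + X) * T + (1 + X) * ((1 + X) * V) := by ring
    rw [this]
    exact add_mem hT.one_add_X_mul (mul_mem one_add_X_mem hZ)
  · have : (T + (1 + X) * V) ^ 2 = T ^ 2 + (1 + X) * T * V + (1 + X) * T * V
        + ((1 + X) * V) ^ 2 := by ring
    rw [this]
    exact add_mem (add_mem (add_mem hT.sq hTZ) hTZ) (pow_mem hZ 2)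
  · have : (T + (1 + X) * V) ^ 3 = T ^ 3 + (T ^ 2 + T ^ 2 + T ^ 2) * ((1 + X) * V) +
        ((1 + X) * T * V + (1 + X) * T * V + (1 + X) * T * V) * ((1 + X) * V)
        + ((1 + X) * V) ^ 3 := by ring
    rw [this]
    exact add_mem (add_mem (add_mem hT.cube
      (mul_mem (add_mem (add_mem hT.sq hT.sq) hT.sq) hZ))
      (mul_mem (add_mem (add_mem hTZ hTZ) hTZ) hZ)) (pow_mem hZ 3)

theorem AlmostNonneg.comp_mem {T : ℤ[X]} (hT : AlmostNonneg T) {c : ℤ[X]}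
    (hc : ∀ i, 0 ≤ c.coeff i)
    (h : C (c.coeff 2) * T ^ 2 + C (c.coeff 1) * T ∈ lifts (Nat.castRingHom ℤ)) :
    c.comp T ∈ lifts (Nat.castRingHom ℤ) := by
  rw [comp, eval₂_eq_sum_range' C (n := c.natDegree + 3) (by omega), Finset.sum_range_succ',
    Finset.sum_range_succ', Finset.sum_range_succ']
  simp only [zero_add, pow_zero, mul_one, pow_one]
  rw [add_assoc _ _ (C (c.coeff 1) * T)]
  refine add_mem (add_mem (sum_mem fun i _ => ?_) h) (C_mem_lifts (hc 0))
  exact mul_mem (C_mem_lifts (hc _)) (hT.pow (i + 1))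

theorem AlmostNonneg.coeff_le_derivative {T : ℤ[X]} (hT : AlmostNonneg T) {c : ℤ[X]}
    (hc : ∀ i, 0 ≤ c.coeff i) (hc2 : 1 ≤ c.coeff 2) (j : ℕ) :
    ((1 + X) * T).coeff j ≤ ((1 + X) * (derivative c).comp T).coeff j := by
  rw [comp, eval₂_eq_sum_range' C (n := (derivative c).natDegree + 2) (by omega), Finset.mul_sum,
    finsetSum_coeff]
  have key : ∀ i, ((1 + X) * (C ((derivative c).coeff i) * T ^ i)).coeff j =
      (derivative c).coeff i * ((1 + X) * T ^ i).coeff j := by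
    intro i
    rw [← coeff_C_mul]
    congr 1
    ring
  have hd : ∀ i, 0 ≤ (derivative c).coeff i := by
    intro i
    rw [coeff_derivative]
    exact mul_nonneg (hc _) (by positivity)
  have h1 := Finset.single_le_sum
    (f := fun i => ((1 + X) * (C ((derivative c).coeff i) * T ^ i)).coeff j)
    (s := Finset.range ((derivative c).natDegree + 2)) (a := 1) (by
      intro i _
      simp only [key]
      exact mul_nonneg (hd i) (mem_lifts_iff.1 (hT.one_add_X_mul_pow i) j)) (by simp)
  refine le_trans ?_ h1
  rw [key 1, pow_one]
  refine le_mul_of_one_le_left (mem_lifts_iff.1 hT.one_add_X_mul j) ?_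
  rw [coeff_derivative]
  norm_num
  linarith

/-- A polynomial with exactly one negative coefficient, all of whose higher powers have
nonnegative coefficients. -/
noncomputable def base (m : ℤ) : ℤ[X] := C m * (1 + X + X ^ 3 + X ^ 4) - X ^ 2

theorem base_sq (m : ℤ) : base m ^ 2 = C (m ^ 2) * (1 + X ^ 8) + C (2 * m ^ 2) * (X + X ^ 7)
    + C (m * (m - 2)) * (X ^ 2 + X ^ 6) + C (2 * m * (m - 1)) * (X ^ 3 + X ^ 5)
    + C (4 * m ^ 2 + 1) * X ^ 4 := by
  simp only [base, map_mul, map_sub, map_pow, map_add, map_one, map_ofNat]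
  ring

theorem base_almostNonneg {m : ℤ} (hm : 3 ≤ m) : AlmostNonneg (base m) := by
  have hX : ∀ n, (X : ℤ[X]) ^ n ∈ lifts (Nat.castRingHom ℤ) := fun n => pow_mem X_mem_lifts' n
  constructor
  · have : (1 + X) * base m = C m * (1 + X ^ 5) + C (2 * m) * (X + X ^ 4)
        + C (m - 1) * (X ^ 2 + X ^ 3) := by
      simp only [base, map_mul, map_sub, map_one, map_ofNat]
      ring
    rw [this]
    refine add_mem (add_mem ?_ ?_) ?_ <;> refine mul_mem (C_mem_lifts (by linarith)) ?_
    exacts [add_mem (one_mem _) (hX _), add_mem X_mem_lifts' (hX _), add_mem (hX _) (hX _)]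
  · rw [base_sq]
    refine add_mem (add_mem (add_mem (add_mem ?_ ?_) ?_) ?_) ?_ <;>
      refine mul_mem (C_mem_lifts (by nlinarith)) ?_
    exacts [add_mem (one_mem _) (hX _), add_mem X_mem_lifts' (hX _), add_mem (hX _) (hX _),
      add_mem (hX _) (hX _), hX _]
  · have h2 : 9 ≤ m ^ 2 := by nlinarith
    have h3 : 3 * m ^ 2 ≤ m ^ 3 := by nlinarith
    have : base m ^ 3 = C (m ^ 3) * (1 + X ^ 12) + C (3 * m ^ 3) * (X + X ^ 11)
        + C (3 * m ^ 3 - 3 * m ^ 2) * (X ^ 2 + X ^ 10)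
        + C (4 * m ^ 3 - 6 * m ^ 2) * (X ^ 3 + X ^ 9)
        + C (9 * m ^ 3 - 3 * m ^ 2 + 3 * m) * (X ^ 4 + X ^ 8)
        + C (9 * m ^ 3 - 6 * m ^ 2 + 3 * m) * (X ^ 5 + X ^ 7)
        + C (6 * m ^ 3 - 12 * m ^ 2 - 1) * X ^ 6 := by
      simp only [base, map_mul, map_sub, map_pow, map_add, map_one, map_ofNat]
      ring
    rw [this]
    refine add_mem (add_mem (add_mem (add_mem (add_mem (add_mem ?_ ?_) ?_) ?_) ?_) ?_) ?_ <;>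
      refine mul_mem (C_mem_lifts (by linarith)) ?_
    exacts [add_mem (one_mem _) (hX _), add_mem X_mem_lifts' (hX _), add_mem (hX _) (hX _),
      add_mem (hX _) (hX _), add_mem (hX _) (hX _), add_mem (hX _) (hX _), hX _]

theorem base_quadratic_mem {m a b : ℤ} (hm : 3 ≤ m) (ha : 1 ≤ a) (hb : 0 ≤ b)
    (hbm : b ≤ m * (m - 2)) :
    C a * base m ^ 2 + C b * base m ∈ lifts (Nat.castRingHom ℤ) := by
  have hX : ∀ n, (X : ℤ[X]) ^ n ∈ lifts (Nat.castRingHom ℤ) := fun n => pow_mem X_mem_lifts' n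
  have : C a * base m ^ 2 + C b * base m = C (a * (m * (m - 2)) - b) * X ^ 2
      + (C a * (C (m ^ 2) * (1 + X ^ 8) + C (2 * m ^ 2) * (X + X ^ 7)
      + C (m * (m - 2)) * X ^ 6 + C (2 * m * (m - 1)) * (X ^ 3 + X ^ 5)
      + C (4 * m ^ 2 + 1) * X ^ 4) + C b * (C m * (1 + X + X ^ 3 + X ^ 4))) := by
    rw [base_sq]
    simp only [base, map_mul, map_sub, map_pow, map_add, map_one, map_ofNat]
    ring
  rw [this]
  refine add_mem (mul_mem (C_mem_lifts (by nlinarith)) (hX _)) (add_mem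
    (mul_mem (C_mem_lifts (by linarith)) ?_) (mul_mem (C_mem_lifts hb) (mul_mem
    (C_mem_lifts (by linarith)) ?_)))
  · refine add_mem (add_mem (add_mem (add_mem ?_ ?_) ?_) ?_) ?_ <;>
      refine mul_mem (C_mem_lifts (by nlinarith)) ?_
    exacts [add_mem (one_mem _) (hX _), add_mem X_mem_lifts' (hX _), hX _,
      add_mem (hX _) (hX _), hX _]
  · exact add_mem (add_mem (add_mem (one_mem _) X_mem_lifts') (hX _)) (hX _)

/-- The polynomial to be evaluated at a power of `q`: `base m` with many further positive
coefficients, two of which are equal to the parameter `u`. -/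
noncomputable def family (m : ℤ) (r B : ℕ) (u : ℤ) : ℤ[X] :=
  base m + (1 + X) * (X ^ 5 * ∑ i ∈ Finset.range r, X ^ i + C u * X ^ B)

theorem eval_le_eval_one_mul_pow {c : ℤ[X]} (hc : ∀ i, 0 ≤ c.coeff i) {y : ℤ} (hy : 1 ≤ y) :
    c.eval y ≤ c.eval 1 * y ^ c.natDegree := by
  rw [eval_eq_sum_range, eval_eq_sum_range, Finset.sum_mul]
  refine Finset.sum_le_sum fun i hi => ?_
  rw [one_pow, mul_one]
  refine mul_le_mul_of_nonneg_left (pow_le_pow_right₀ hy ?_) (hc i)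
  simp at hi
  omega

theorem coeff_sum_X_pow {R : Type*} [Semiring R] (r j : ℕ) :
    (∑ i ∈ Finset.range r, (X : R[X]) ^ i).coeff j = if j < r then 1 else 0 := by
  simp [finsetSum_coeff, coeff_X_pow]

theorem sum_X_pow_mem (r : ℕ) :
    (∑ i ∈ Finset.range r, (X : ℤ[X]) ^ i) ∈ lifts (Nat.castRingHom ℤ) :=
  sum_mem fun _ _ => pow_mem X_mem_lifts' _

theorem family_almostNonneg {m : ℤ} (hm : 3 ≤ m) (r B : ℕ) {u : ℤ} (hu : 0 ≤ u) :
    AlmostNonneg (family m r B u) :=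
  (base_almostNonneg hm).add_one_add_X_mul (add_mem (mul_mem (pow_mem X_mem_lifts' _) (sum_X_pow_mem r))
    (mul_mem (C_mem_lifts hu) (pow_mem X_mem_lifts' _)))

theorem family_comp_mem {c : ℤ[X]} (hc : ∀ i, 0 ≤ c.coeff i) (hc2 : 1 ≤ c.coeff 2)
    {m : ℤ} (hm : 3 ≤ m) (hcm : c.coeff 1 ≤ m * (m - 2)) (r B : ℕ) {u : ℤ} (hu : 0 ≤ u) :
    c.comp (family m r B u) ∈ lifts (Nat.castRingHom ℤ) := by
  refine (family_almostNonneg hm r B hu).comp_mem hc ?_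
  have hV : X ^ 5 * ∑ i ∈ Finset.range r, X ^ i + C u * X ^ B ∈ lifts (Nat.castRingHom ℤ) :=
    add_mem (mul_mem (pow_mem X_mem_lifts' _) (sum_X_pow_mem r))
      (mul_mem (C_mem_lifts hu) (pow_mem X_mem_lifts' _))
  unfold family
  generalize X ^ 5 * ∑ i ∈ Finset.range r, X ^ i + C u * X ^ B = V at hV
  have hZ := mul_mem one_add_X_mem hV
  have hTZ := mul_mem (base_almostNonneg hm).one_add_X_mul hV
  have : C (c.coeff 2) * (base m + (1 + X) * V) ^ 2 + C (c.coeff 1) * (base m + (1 + X) * V) =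
      (C (c.coeff 2) * base m ^ 2 + C (c.coeff 1) * base m) +
      (C (c.coeff 2) * ((1 + X) * base m * V + (1 + X) * base m * V + ((1 + X) * V) ^ 2)
        + C (c.coeff 1) * ((1 + X) * V)) := by ring
  rw [this]
  exact add_mem (base_quadratic_mem hm hc2 (hc 1) hcm) (add_mem (mul_mem (C_mem_lifts (hc 2))
    (add_mem (add_mem hTZ hTZ) (pow_mem hZ 2))) (mul_mem (C_mem_lifts (hc 1)) hZ))

theorem natDegree_family_le {m : ℤ} {r B : ℕ} (hB : r + 5 ≤ B) (u : ℤ) :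
    (family m r B u).natDegree ≤ B + 1 := by
  have h1 : (base m).natDegree ≤ B + 1 := by
    refine le_trans (?_ : _ ≤ 4) (by omega)
    unfold base
    compute_degree
  have h2 : (∑ i ∈ Finset.range r, (X : ℤ[X]) ^ i).natDegree ≤ r := by
    refine natDegree_sum_le_of_forall_le _ _ fun i hi => ?_
    simp at hi
    simp
    omega
  refine natDegree_add_le_of_degree_le h1 ?_
  rw [add_comm B 1]
  refine natDegree_mul_le_of_le ?_ (natDegree_add_le_of_degree_le ?_ ?_)
  · compute_degree
  · refine le_trans (natDegree_mul_le_of_le (natDegree_X_pow_le 5) h2) (by omega)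
  · exact natDegree_C_mul_X_pow_le _ _

theorem coeff_comp_family (c : ℤ[X]) (m : ℤ) {r B j : ℕ} (u : ℤ) (hj : j < B)
    (hB : (c.comp (family m r 0 0)).natDegree < B) :
    (c.comp (family m r B u)).coeff (j + B) =
      u * ((1 + X) * (derivative c).comp (family m r 0 0)).coeff j := by
  have h1 : family m r B u = family m r 0 0 + (1 + X) * (C u * X ^ B) := by
    simp only [family, C_0]
    ring
  obtain ⟨k, hk⟩ := binomExpansion (c.map C) (family m r 0 0) ((1 + X) * (C u * X ^ B))
  rw [derivative_map, eval_map, eval_map, eval_map, ← h1] at hk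
  change c.comp _ = c.comp _ + (derivative c).comp _ * _ + _ at hk
  have h2 : (derivative c).comp (family m r 0 0) * ((1 + X) * (C u * X ^ B)) =
      C u * ((1 + X) * (derivative c).comp (family m r 0 0)) * X ^ B := by ring
  have h3 : k * ((1 + X) * (C u * X ^ B)) ^ 2 = k * ((1 + X) * C u) ^ 2 * X ^ B * X ^ B := by ring
  rw [hk, h2, h3, coeff_add, coeff_add, coeff_mul_X_pow, coeff_mul_X_pow, coeff_C_mul,
    coeff_eq_zero_of_natDegree_lt (by omega), coeff_mul_X_pow', if_neg (by omega)]
  ring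

theorem one_le_coeff_family {m : ℤ} (hm : 3 ≤ m) {r i : ℕ} (hi : i < r) :
    1 ≤ ((1 + X) * family m r 0 0).coeff (i + 5) := by
  have h : (1 + X) * family m r 0 0 = (1 + X) * base m + (X + X + X ^ 2) *
      (X ^ 5 * ∑ i ∈ Finset.range r, X ^ i) + (∑ i ∈ Finset.range r, X ^ i) * X ^ 5 := by
    simp only [family, C_0]
    ring
  have h1 := mem_lifts_iff.1 (base_almostNonneg hm).one_add_X_mul (i + 5)
  have h2 : (X + X + X ^ 2) * (X ^ 5 * ∑ i ∈ Finset.range r, X ^ i) ∈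
      lifts (Nat.castRingHom ℤ) :=
    mul_mem (add_mem (add_mem X_mem_lifts' X_mem_lifts') (pow_mem X_mem_lifts' _))
      (mul_mem (pow_mem X_mem_lifts' _) (sum_X_pow_mem r))
  have h3 := mem_lifts_iff.1 h2 (i + 5)
  rw [h, coeff_add, coeff_add, coeff_mul_X_pow, coeff_sum_X_pow, if_pos hi]
  linarith

theorem eval_family (m : ℤ) (r B : ℕ) (u x : ℤ) : (family m r B u).eval x =
    m * (1 + x + x ^ 3 + x ^ 4) - x ^ 2 +
      (1 + x) * (x ^ 5 * ∑ i ∈ Finset.range r, x ^ i + u * x ^ B) := by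
  simp [family, base, eval_finsetSum]

theorem exists_lift_comp_family {c : ℤ[X]} (hc : ∀ i, 0 ≤ c.coeff i) (hc2 : 1 ≤ c.coeff 2)
    {m : ℤ} (hm : 3 ≤ m) (hcm : c.coeff 1 ≤ m * (m - 2)) (r : ℕ) :
    ∃ B A K : ℕ, r + 5 < B ∧ B + 5 + r ≤ K ∧ ∀ u : ℕ, 1 ≤ u → ∃ P : ℕ[X],
      P.map (Nat.castRingHom ℤ) = c.comp (family m r B u) ∧ P.natDegree < K ∧
      P.eval 1 ≤ A * u ^ c.natDegree ∧
      ∀ i < r, ∃ a, 1 ≤ a ∧ a ≤ A ∧ P.coeff (i + 5 + B) = a * u := by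
  set T₀ := family m r 0 0 with hT₀
  set W := (1 + X) * (derivative c).comp T₀ with hW
  obtain ⟨B, hB1, hB2⟩ : ∃ B, r + 5 < B ∧ (c.comp T₀).natDegree < B :=
    ⟨r + 5 + ((c.comp T₀).natDegree + 1), by omega, by omega⟩
  set A₁ := ∑ i ∈ Finset.range r, (W.coeff (i + 5)).toNat with hA₁
  set C₁ : ℤ := 4 * m + 2 * r + 2 with hC₁
  set A₂ := (c.eval 1 * C₁ ^ c.natDegree).toNat with hA₂
  refine ⟨B, A₁ + A₂, c.natDegree * (B + 1) + 1 + (B + 5 + r), hB1, by omega, ?_⟩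
  intro u hu
  obtain ⟨P, hP⟩ := mem_lifts _ |>.1 (family_comp_mem hc hc2 hm hcm r B (u := u) (by positivity))
  have hcoeff : ∀ i, ((P.coeff i : ℕ) : ℤ) = (c.comp (family m r B u)).coeff i := by
    intro i
    rw [← hP, coeff_map]
    rfl
  refine ⟨P, hP, ?_, ?_, ?_⟩
  · have h1 : P.natDegree = (c.comp (family m r B u)).natDegree := by
      rw [← hP, natDegree_map_eq_of_injective Nat.cast_injective]
    rw [natDegree_comp] at h1
    have := Nat.mul_le_mul_left c.natDegree (natDegree_family_le (m := m) hB1.le u)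
    omega
  · have h1 : ((P.eval 1 : ℕ) : ℤ) = c.eval ((family m r B u).eval 1) := by
      rw [← eval_comp, ← hP, eval_one_map]
      rfl
    have hu' : (1 : ℤ) ≤ u := by exact_mod_cast hu
    have h2 : (family m r B u).eval 1 ≤ C₁ * u := by
      rw [eval_family]
      simp only [one_pow, Finset.sum_const, Finset.card_range, nsmul_eq_mul]
      nlinarith
    have h3 : 1 ≤ (family m r B u).eval 1 := by
      rw [eval_family]
      simp only [one_pow, Finset.sum_const, Finset.card_range, nsmul_eq_mul]
      nlinarith
    have h4 := eval_le_eval_one_mul_pow hc h3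
    have h5 : 0 ≤ c.eval 1 := by
      rw [eval_eq_sum_range]
      exact Finset.sum_nonneg fun i _ => by simpa using hc i
    have h6 : ((P.eval 1 : ℕ) : ℤ) ≤ A₂ * (u : ℤ) ^ c.natDegree := by
      rw [h1]
      refine h4.trans ?_
      calc _ ≤ c.eval 1 * (C₁ * u) ^ c.natDegree := by gcongr
        _ = (c.eval 1 * C₁ ^ c.natDegree) * (u : ℤ) ^ c.natDegree := by rw [mul_pow]; ring
        _ ≤ _ := by gcongr; exact Int.self_le_toNat _
    have h7 : P.eval 1 ≤ A₂ * u ^ c.natDegree := by exact_mod_cast h6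
    exact h7.trans (Nat.mul_le_mul_right _ (by omega))
  · intro i hi
    have h1 : 1 ≤ W.coeff (i + 5) := (one_le_coeff_family hm hi).trans
      ((family_almostNonneg hm r 0 le_rfl).coeff_le_derivative hc hc2 _)
    refine ⟨(W.coeff (i + 5)).toNat, by omega, ?_, ?_⟩
    · refine le_trans ?_ (Nat.le_add_right A₁ A₂)
      exact Finset.single_le_sum (f := fun i => (W.coeff (i + 5)).toNat)
        (fun _ _ => Nat.zero_le _) (by simpa using hi)
    · zify
      rw [hcoeff, coeff_comp_family c m u (by omega) hB2, Int.toNat_of_nonneg (by omega), mul_comm]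

theorem eventually_eval_pos {Q : ℤ[X]} (hQ : 0 < Q.leadingCoeff) :
    ∀ᶠ n : ℕ in Filter.atTop, 0 < Q.eval (n : ℤ) := by
  rcases Nat.eq_zero_or_pos Q.natDegree with h | h
  · rw [leadingCoeff, h] at hQ
    rw [eq_C_of_natDegree_eq_zero h]
    simp [hQ]
  · have hinj : Function.Injective (Int.castRingHom ℝ) := Int.cast_injective
    have h1 : Filter.Tendsto (fun x : ℝ => (Q.map (Int.castRingHom ℝ)).eval x)
        Filter.atTop Filter.atTop := by
      refine tendsto_atTop_of_leadingCoeff_nonneg _ ?_ ?_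
      · rw [degree_map_eq_of_injective hinj]
        exact natDegree_pos_iff_degree_pos.1 h
      · rw [leadingCoeff_map_of_injective hinj]
        simpa using hQ.le
    have h2 := (h1.comp tendsto_natCast_atTop_atTop).eventually_gt_atTop 0
    filter_upwards [h2] with n hn
    have h3 : (Q.map (Int.castRingHom ℝ)).eval (n : ℝ) = ((Q.eval (n : ℤ) : ℤ) : ℝ) := by
      rw [← Int.cast_natCast, eval_intCast_map]
      rfl
    simp only [Function.comp_apply, h3] at hn
    exact_mod_cast hn

theorem exists_shift {p : ℤ[X]} (hdeg : 2 ≤ p.natDegree) (hlead : 0 < p.leadingCoeff) {q : ℕ}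
    (hq : 2 ≤ q) : ∃ M : ℕ, q ∣ M ∧ (∀ i, 0 ≤ (taylor (M : ℤ) p).coeff i) ∧
      1 ≤ (taylor (M : ℤ) p).coeff 2 := by
  have key : ∀ i ≤ p.natDegree, ∀ᶠ M : ℕ in Filter.atTop, 0 < (taylor (M : ℤ) p).coeff i := by
    intro i hi
    have h : 0 < (hasseDeriv i p).leadingCoeff := by
      rw [leadingCoeff, natDegree_hasseDeriv, hasseDeriv_coeff, Nat.sub_add_cancel hi]
      exact mul_pos (by exact_mod_cast Nat.choose_pos hi) hlead
    simpa only [taylor_coeff] using eventually_eval_pos h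
  have h1 : ∀ᶠ M : ℕ in Filter.atTop, ∀ i ∈ Finset.range (p.natDegree + 1),
      0 < (taylor (M : ℤ) p).coeff i := by
    rw [Filter.eventually_all_finset]
    intro i hi
    exact key i (by simp at hi; omega)
  obtain ⟨M₀, hM₀⟩ := Filter.eventually_atTop.1 h1
  have h2 := hM₀ (q * M₀) (Nat.le_mul_of_pos_left _ (by omega))
  refine ⟨q * M₀, dvd_mul_right _ _, fun i => ?_, h2 2 (by simp; omega)⟩
  by_cases hi : i ≤ p.natDegree
  · exact (h2 i (by simp; omega)).le
  · rw [coeff_eq_zero_of_natDegree_lt (by rw [natDegree_taylor]; omega)]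

/-- The part of `M + family m r B u` with nonnegative coefficients. -/
noncomputable def shiftedPart (M m r B u : ℕ) : ℕ[X] :=
  C (M + m) + C m * X + X ^ 3 * (C (m - 1) + C m * X + X ^ 2 * (1 + X) *
    ∑ i ∈ Finset.range r, X ^ i) + C u * X ^ B + C u * X ^ (B + 1)

theorem coeff_shiftedPart (M m r B u i : ℕ) : (shiftedPart M m r B u).coeff i =
    (shiftedPart M m r B 0).coeff i + (if i = B then u else 0) + (if i = B + 1 then u else 0) := by
  have : shiftedPart M m r B u = shiftedPart M m r B 0 + C u * X ^ B + C u * X ^ (B + 1) := by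
    simp [shiftedPart]
  rw [this, coeff_add, coeff_add, coeff_C_mul_X_pow, coeff_C_mul_X_pow]

theorem coeff_two_shiftedPart {M m r B : ℕ} (hB : r + 5 ≤ B) (u : ℕ) :
    (shiftedPart M m r B u).coeff 2 = 0 := by
  rw [coeff_shiftedPart, if_neg (by omega), if_neg (by omega), shiftedPart]
  simp only [coeff_add, coeff_X_pow_mul', coeff_C, coeff_C_mul, coeff_X]
  simp

theorem natDegree_shiftedPart_zero (M m r B : ℕ) :
    (shiftedPart M m r B 0).natDegree ≤ r + 5 := by
  have h : (∑ i ∈ Finset.range r, (X : ℕ[X]) ^ i).natDegree ≤ r - 1 := by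
    refine natDegree_sum_le_of_forall_le _ _ fun i hi => ?_
    simp only [Finset.mem_range] at hi
    simp only [natDegree_X_pow]
    omega
  have h1 : (X ^ 2 * (1 + X) * ∑ i ∈ Finset.range r, (X : ℕ[X]) ^ i).natDegree ≤ r + 2 := by
    rcases Nat.eq_zero_or_pos r with rfl | hr
    · simp
    · have h2 : (X ^ 2 * (1 + X) : ℕ[X]).natDegree ≤ 3 := by compute_degree
      exact (natDegree_mul_le_of_le h2 h).trans (by omega)
  have h2 : (C (m - 1) + C m * X : ℕ[X]).natDegree ≤ r + 2 := by
    refine le_trans (?_ : _ ≤ 1) (by omega)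
    compute_degree
  have h3 : (C (M + m) + C m * X : ℕ[X]).natDegree ≤ r + 5 := by
    refine le_trans (?_ : _ ≤ 1) (by omega)
    compute_degree
  rw [shiftedPart]
  simp only [C_0, zero_mul, add_zero]
  refine natDegree_add_le_of_degree_le h3 ?_
  refine (natDegree_mul_le_of_le (natDegree_X_pow_le 3)
    (natDegree_add_le_of_degree_le h2 h1)).trans (by omega)

theorem eval_shiftedPart (M m r B u x : ℕ) : (shiftedPart M m r B u).eval x =
    (M + m) + x * (m + x * (x * (m - 1 + m * x + x ^ 2 * (1 + x) *
      ∑ i ∈ Finset.range r, x ^ i))) + u * x ^ B * (1 + x) := by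
  simp only [shiftedPart, eval_add, eval_mul, eval_C, eval_X, eval_pow, eval_one, eval_finsetSum]
  ring

theorem shiftedPart_eq_family {M m r B u x : ℕ} (hm : 1 ≤ m) (hx : 1 ≤ x) :
    (((shiftedPart M m r B u).eval x + (x - 1) * x ^ 2 : ℕ) : ℤ) =
      M + (family m r B u).eval (x : ℤ) := by
  rw [eval_shiftedPart, eval_family]
  push_cast [Nat.cast_sub hm, Nat.cast_sub hx]
  ring

theorem sum_digitSum_shiftedPart {M m r B q : ℕ} (hB : r + 5 < B) (u : ℕ) :
    ∑ i ∈ Finset.range (B + 2), digitSum q ((shiftedPart M m r B u).coeff i) =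
      ∑ i ∈ Finset.range B, digitSum q ((shiftedPart M m r B 0).coeff i)
        + 2 * digitSum q u := by
  have h : ∀ i, B ≤ i → (shiftedPart M m r B 0).coeff i = 0 := fun i hi =>
    coeff_eq_zero_of_natDegree_lt ((natDegree_shiftedPart_zero M m r B).trans_lt (by omega))
  rw [Finset.sum_range_succ, Finset.sum_range_succ, coeff_shiftedPart _ _ _ _ _ B,
    coeff_shiftedPart _ _ _ _ _ (B + 1), h B le_rfl, h (B + 1) (by omega)]
  have : ∀ i ∈ Finset.range B, digitSum q ((shiftedPart M m r B u).coeff i) =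
      digitSum q ((shiftedPart M m r B 0).coeff i) := by
    intro i hi
    simp only [Finset.mem_range] at hi
    rw [coeff_shiftedPart, if_neg (by omega), if_neg (by omega)]
    rfl
  rw [Finset.sum_congr rfl this]
  simp
  ring

theorem digitSum_shiftedPart {M m r B q k u : ℕ} (hq : 2 ≤ q) (hB : r + 5 < B)
    (hu : u < q ^ k) (h1 : (shiftedPart M m r B 0).eval 1 < q ^ k) :
    digitSum q ((shiftedPart M m r B u).eval (q ^ k) + (q ^ k - 1) * (q ^ k) ^ 2) =
      ∑ i ∈ Finset.range B, digitSum q ((shiftedPart M m r B 0).coeff i)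
        + 2 * digitSum q u + (q - 1) * k ∧
    (shiftedPart M m r B u).eval (q ^ k) + (q ^ k - 1) * (q ^ k) ^ 2 < (q ^ k) ^ (B + 2) := by
  have hqk : 1 ≤ q ^ k := Nat.one_le_pow _ _ (by omega)
  have hdeg := natDegree_shiftedPart_zero M m r B
  set Q := shiftedPart M m r B u + C (q ^ k - 1) * X ^ 2 with hQ
  have hcoeff : ∀ i, Q.coeff i = (shiftedPart M m r B u).coeff i + if i = 2 then q ^ k - 1 else 0 := by
    intro i
    rw [hQ, coeff_add, coeff_C_mul_X_pow]
  have hlt : ∀ i, Q.coeff i < q ^ k := by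
    intro i
    rw [hcoeff]
    by_cases h2 : i = 2
    · rw [h2, coeff_two_shiftedPart hB.le]
      simp
      omega
    · rw [coeff_shiftedPart, if_neg h2]
      have := coeff_le_eval_one (shiftedPart M m r B 0) i
      by_cases hi : B ≤ i
      · rw [coeff_eq_zero_of_natDegree_lt (by omega)]
        split_ifs <;> omega
      · rw [if_neg (by omega), if_neg (by omega)]
        omega
  have hQdeg : Q.natDegree < B + 2 := by
    rw [Nat.lt_succ_iff, natDegree_le_iff_coeff_eq_zero]
    intro i hi
    rw [hcoeff, coeff_shiftedPart, coeff_eq_zero_of_natDegree_lt (by omega)]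
    simp
    omega
  have heval : Q.eval (q ^ k) = (shiftedPart M m r B u).eval (q ^ k) + (q ^ k - 1) * (q ^ k) ^ 2 := by
    simp [hQ]
  rw [← heval]
  constructor
  · rw [digitSum_eval hq hlt hQdeg, ← sum_digitSum_shiftedPart hB]
    have : ∀ i, digitSum q (Q.coeff i) = digitSum q ((shiftedPart M m r B u).coeff i) +
        if i = 2 then (q - 1) * k else 0 := by
      intro i
      rw [hcoeff]
      by_cases h2 : i = 2
      · rw [h2, coeff_two_shiftedPart hB.le]
        simp [digitSum_pow_sub_one hq, digitSum_zero]
      · simp [h2]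
    rw [Finset.sum_congr rfl fun i _ => this i, Finset.sum_add_distrib, Finset.sum_ite_eq',
      if_pos (by simp; omega)]
  · rw [eval_eq_sum_range' hQdeg]
    exact sum_mul_pow_lt _ _ hlt hqk

theorem shiftedPart_injective {M m r B q k k' u u' : ℕ} (hq : 2 ≤ q) (hB : 2 ≤ B) (hm : m % q = 1)
    (hk : 1 ≤ k) (hk' : 1 ≤ k')
    (h : (shiftedPart M m r B u).eval (q ^ k) + (q ^ k - 1) * (q ^ k) ^ 2 =
      (shiftedPart M m r B u').eval (q ^ k') + (q ^ k' - 1) * (q ^ k') ^ 2) : u = u' := by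
  have form : ∀ u k, ∃ z, (shiftedPart M m r B u).eval (q ^ k) + (q ^ k - 1) * (q ^ k) ^ 2 =
      M + m + q ^ k * (m + q ^ k * z) := by
    intro u k
    obtain ⟨b, rfl⟩ : ∃ b, B = b + 2 := ⟨B - 2, by omega⟩
    rw [eval_shiftedPart]
    refine ⟨q ^ k * (m - 1 + m * q ^ k + (q ^ k) ^ 2 * (1 + q ^ k) *
      ∑ i ∈ Finset.range r, (q ^ k) ^ i) + u * (q ^ k) ^ b * (1 + q ^ k) + (q ^ k - 1), ?_⟩
    ring
  have aux : ∀ k l z z' : ℕ, 1 ≤ k → k < l →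
      M + m + q ^ k * (m + q ^ k * z) ≠ M + m + q ^ l * (m + q ^ l * z') := by
    intro k l z z' hk hl he
    obtain ⟨j, rfl⟩ : ∃ j, l = k + (j + 1) := ⟨l - k - 1, by omega⟩
    obtain ⟨k, rfl⟩ : ∃ k', k = k' + 1 := ⟨k - 1, by omega⟩
    have h1 : q ^ (k + 1) * (m + q ^ (k + 1) * z) =
        q ^ (k + 1) * (q * (q ^ j * (m + q ^ (k + 1 + (j + 1)) * z'))) := by
      rw [Nat.add_left_cancel he]
      ring
    have h2 := Nat.eq_of_mul_eq_mul_left (by positivity) h1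
    have h3 : (m + q ^ (k + 1) * z) % q = 1 := by
      rw [pow_succ', mul_assoc, Nat.add_mul_mod_self_left, hm]
    rw [h2, Nat.mul_mod_right] at h3
    omega
  obtain rfl : k = k' := by
    obtain ⟨z, hz⟩ := form u k
    obtain ⟨z', hz'⟩ := form u' k'
    rw [hz, hz'] at h
    rcases lt_trichotomy k k' with hlt | heq | hlt
    · exact absurd h (aux _ _ _ _ hk hlt)
    · exact heq
    · exact absurd h.symm (aux _ _ _ _ hk' hlt)
  rw [eval_shiftedPart, eval_shiftedPart] at h
  have h1 := Nat.add_left_cancel (Nat.add_right_cancel h)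
  have h2 := Nat.eq_of_mul_eq_mul_right (by positivity) h1
  exact Nat.eq_of_mul_eq_mul_right (by positivity) h2

theorem shiftedPart_not_dvd {M m r B q k : ℕ} (u : ℕ) (hB : 1 ≤ B) (hM : q ∣ M)
    (hm : m % q = 1) (hk : 1 ≤ k) :
    ¬ q ∣ (shiftedPart M m r B u).eval (q ^ k) + (q ^ k - 1) * (q ^ k) ^ 2 := by
  have hdvd : q ∣ q ^ k := dvd_pow_self q (by omega)
  have h2 : q ∣ (q ^ k) ^ 2 := hdvd.trans (dvd_pow_self _ (by norm_num))
  have hB' : q ∣ (q ^ k) ^ B := hdvd.trans (dvd_pow_self _ (by omega))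
  rw [eval_shiftedPart, Nat.dvd_add_left (h2.mul_left _),
    Nat.dvd_add_left ((hB'.mul_left _).mul_right _), Nat.dvd_add_left (hdvd.mul_right _),
    Nat.dvd_add_right hM, Nat.dvd_iff_mod_eq_zero, hm]
  omega

theorem exists_nearest {D s : ℕ} (hs : 1 ≤ s) :
    ∃ k : ℕ, 2 * D ≤ 2 * (s * k) + s ∧ 2 * (s * k) ≤ 2 * D + s := by
  refine ⟨(2 * D + s) / (2 * s), ?_, ?_⟩
  · have := Nat.lt_mul_div_succ (2 * D + s) (show 0 < 2 * s by omega)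
    nlinarith
  · have := Nat.mul_div_le (2 * D + s) (2 * s)
    nlinarith

/-- A polynomial lower bound along the powers `q ^ (E * L)` gives one for all large `N`. -/
theorem exists_rpow_le {q : ℕ} (hq : 2 ≤ q) {f : ℕ → ℕ} (hf : Monotone f) {E L₀ : ℕ} (hE : 1 ≤ E)
    (h : ∀ L, L₀ ≤ L → q ^ L ≤ f (q ^ (E * L))) :
    ∃ γ : ℝ, 0 < γ ∧ ∃ c : ℝ, 0 < c ∧ ∃ N₀ : ℕ, ∀ N : ℕ, N₀ ≤ N → c * (N : ℝ) ^ γ ≤ f N := by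
  have hE' : (0 : ℝ) < E := by exact_mod_cast hE
  have hq' : (0 : ℝ) < q := by exact_mod_cast (by omega : 0 < q)
  refine ⟨1 / E, by positivity, 1 / q, by positivity, q ^ (E * L₀), fun N hN => ?_⟩
  have hQ : 1 < q ^ E := Nat.one_lt_pow (by omega) (by omega)
  have hN0 : N ≠ 0 := by
    have : 0 < q ^ (E * L₀) := by positivity
    omega
  set L := Nat.log (q ^ E) N with hL
  have h1 : q ^ (E * L) ≤ N := by
    rw [pow_mul]
    exact Nat.pow_log_le_self _ hN0
  have h2 : N < q ^ (E * (L + 1)) := by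
    rw [pow_mul]
    exact Nat.lt_pow_succ_log_self hQ N
  have h3 : L₀ ≤ L := Nat.le_log_of_pow_le hQ (by rwa [← pow_mul])
  have h4 : (N : ℝ) ^ (1 / (E : ℝ)) ≤ q ^ (L + 1) := by
    rw [one_div, Real.rpow_inv_le_iff_of_pos (by positivity) (by positivity) hE',
      Real.rpow_natCast, ← pow_mul, mul_comm]
    exact_mod_cast h2.le
  calc 1 / (q : ℝ) * (N : ℝ) ^ (1 / (E : ℝ)) ≤ 1 / q * q ^ (L + 1) := by gcongr
    _ = (q ^ L : ℕ) := by push_cast; field_simp; ring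
    _ ≤ (f (q ^ (E * L)) : ℕ) := by exact_mod_cast h L h3
    _ ≤ f N := by exact_mod_cast hf h1

theorem exists_balanced {q : ℕ} (hq : 2 ≤ q) {p : ℤ[X]} {M m r B A K D : ℕ} (hM : q ∣ M)
    (hm : m % q = 1) (hr : r = 3 * D + 6) (hB : r + 5 < B) (hK : B + 5 + r ≤ K)
    (hP : ∀ u : ℕ, 1 ≤ u → ∃ P : ℕ[X],
      P.map (Nat.castRingHom ℤ) = (taylor (M : ℤ) p).comp (family m r B u) ∧ P.natDegree < K ∧
      P.eval 1 ≤ A * u ^ D ∧ ∀ i < r, ∃ a, 1 ≤ a ∧ a ≤ A ∧ P.coeff (i + 5 + B) = a * u)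
    {L w : ℕ} (hL : 1 ≤ L) (hA : A < q ^ L) (hR : (shiftedPart M m r B 0).eval 1 < q ^ L)
    (hS : ∑ i ∈ Finset.range B, digitSum q ((shiftedPart M m r B 0).coeff i) ≤ L)
    (hw1 : 1 ≤ w) (hw : w ≤ q ^ L) :
    ∃ k n : ℕ, 1 ≤ k ∧
      n = (shiftedPart M m r B (w * (q ^ (2 * L) - 1))).eval (q ^ k) + (q ^ k - 1) * (q ^ k) ^ 2 ∧
      n < q ^ (K * (3 * D + 1) * (B + 2) * L) ∧ ¬ q ∣ n ∧
      2 * |(digitSum q (p.eval (n : ℤ)).toNat : ℤ) - (digitSum q n : ℤ)| ≤ (q : ℤ) - 1 := by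
  have hm1 : 1 ≤ m := by
    by_contra! h0
    obtain rfl : m = 0 := by omega
    simp at hm
  set u := w * (q ^ (2 * L) - 1) with hu
  have hqL : 2 ≤ q ^ (2 * L) := hq.trans (Nat.le_self_pow (by omega) q)
  have hu1 : 1 ≤ u := Nat.mul_pos hw1 (by omega)
  have hu3 : u < q ^ (3 * L) := by
    calc u ≤ q ^ L * (q ^ (2 * L) - 1) := Nat.mul_le_mul_right _ hw
      _ < q ^ L * q ^ (2 * L) := Nat.mul_lt_mul_of_pos_left (by omega) (by positivity)
      _ = q ^ (3 * L) := by rw [← pow_add]; congr 1; ring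
  have hLL : q ^ L * q ^ L = q ^ (2 * L) := by rw [← pow_add]; congr 1; ring
  have hds : ∀ a, 1 ≤ a → a ≤ A → digitSum q (a * u) = (q - 1) * (2 * L) := by
    intro a ha haA
    rw [hu, ← mul_assoc, digitSum_mul_pow_sub_one hq (Nat.mul_pos ha hw1)]
    rw [← hLL]
    exact Nat.mul_le_mul (by omega) hw
  have hdu : digitSum q u = (q - 1) * (2 * L) :=
    digitSum_mul_pow_sub_one hq hw1 (hw.trans (Nat.pow_le_pow_right (by omega) (by omega)))
  obtain ⟨P, hPmap, hPdeg, hP1, hPi⟩ := hP u hu1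
  have hPlt : ∀ i, P.coeff i < q ^ ((3 * D + 1) * L) := by
    intro i
    calc P.coeff i ≤ A * u ^ D := (coeff_le_eval_one P i).trans hP1
      _ ≤ A * (q ^ (3 * L)) ^ D := by gcongr
      _ < q ^ L * (q ^ (3 * L)) ^ D := Nat.mul_lt_mul_of_pos_right hA (by positivity)
      _ = q ^ ((3 * D + 1) * L) := by rw [← pow_mul, ← pow_add]; congr 1; ring
  set SP := ∑ i ∈ Finset.range K, digitSum q (P.coeff i) with hSP
  set SR := ∑ i ∈ Finset.range B, digitSum q ((shiftedPart M m r B 0).coeff i) with hSR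
  have hSP_le : SP ≤ K * ((q - 1) * ((3 * D + 1) * L)) := by
    have := Finset.sum_le_card_nsmul (Finset.range K) (fun i => digitSum q (P.coeff i)) _
      fun i _ => digitSum_le hq (hPlt i)
    simpa using this
  have hle_SP : r * ((q - 1) * (2 * L)) ≤ SP := by
    have h1 : ∑ i ∈ (Finset.range r).image (fun i => i + 5 + B), digitSum q (P.coeff i) ≤ SP := by
      refine Finset.sum_le_sum_of_subset ?_
      intro j hj
      simp only [Finset.mem_image, Finset.mem_range] at hj ⊢
      omega
    rw [Finset.sum_image (by intro a _ b _ h; simpa using h)] at h1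
    have h2 : ∀ i ∈ Finset.range r, digitSum q (P.coeff (i + 5 + B)) = (q - 1) * (2 * L) := by
      intro i hi
      obtain ⟨a, ha1, ha2, ha⟩ := hPi i (by simpa using hi)
      rw [ha, hds a ha1 ha2]
    rw [Finset.sum_congr rfl h2] at h1
    simpa using h1
  obtain ⟨s, hs⟩ : ∃ s, q - 1 = s := ⟨_, rfl⟩
  have hs1 : 1 ≤ s := by omega
  rw [hs] at hSP_le hle_SP hdu
  have hLs : L ≤ s * L := Nat.le_mul_of_pos_left _ hs1
  have hDs : 0 ≤ D * (s * L) := Nat.zero_le _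
  have hle : SR + 2 * (s * (2 * L)) ≤ SP := by
    rw [hr] at hle_SP
    linarith
  obtain ⟨k, hk1, hk2⟩ := exists_nearest (D := SP - (SR + 2 * (s * (2 * L)))) hs1
  obtain ⟨D₀, hD₀⟩ := Nat.exists_eq_add_of_le hle
  rw [hD₀, Nat.add_sub_cancel_left] at hk1 hk2
  have hk_ge : (3 * D + 3) * L ≤ k := by
    by_contra! hlt
    rw [hr, hD₀] at hle_SP
    have h1 : s * (k + 1) ≤ s * ((3 * D + 3) * L) := Nat.mul_le_mul_left _ hlt
    linarith
  have hk_le : k ≤ K * (3 * D + 1) * L := by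
    by_contra! hlt
    have h1 : s * (K * (3 * D + 1) * L + 1) ≤ s * k := Nat.mul_le_mul_left _ hlt
    rw [hD₀] at hSP_le
    linarith
  have hk0 : 1 ≤ k := hL.trans ((Nat.le_mul_of_pos_left L (by omega)).trans hk_ge)
  have hpow : ∀ {e}, e ≤ (3 * D + 3) * L → q ^ e ≤ q ^ k := fun he =>
    Nat.pow_le_pow_right (by omega) (he.trans hk_ge)
  obtain ⟨hdn, hn⟩ := digitSum_shiftedPart (M := M) (m := m) hq hB
    (hu3.trans_le (hpow (Nat.mul_le_mul_right L (by omega))))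
    (hR.trans_le (hpow (Nat.le_mul_of_pos_left L (by omega))))
  refine ⟨k, _, hk0, rfl, ?_, shiftedPart_not_dvd u (by omega) hM hm hk0, ?_⟩
  · refine hn.trans_le ?_
    rw [← pow_mul]
    refine Nat.pow_le_pow_right (by omega) ?_
    calc k * (B + 2) ≤ K * (3 * D + 1) * L * (B + 2) := Nat.mul_le_mul_right _ hk_le
      _ = _ := by ring
  · rw [hdn, ← hSR]
    have hpn : (p.eval (((shiftedPart M m r B u).eval (q ^ k) + (q ^ k - 1) * (q ^ k) ^ 2 : ℕ) : ℤ))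
        = ((P.eval (q ^ k) : ℕ) : ℤ) := by
      rw [shiftedPart_eq_family hm1 (Nat.one_le_pow _ _ (by omega)), add_comm, ← taylor_eval,
        ← eval_comp, ← hPmap, eval_natCast_map]
      rfl
    rw [hpn, Int.toNat_natCast, digitSum_eval hq
      (fun i => (hPlt i).trans_le (hpow (Nat.mul_le_mul_right L (by omega)))) hPdeg,
      ← hSP, hD₀, hdu, hs]
    have hqs : (q : ℤ) - 1 = s := by omega
    rw [hqs]
    zify at hk1 hk2
    push_cast
    have h1 : (SR : ℤ) + 2 * (s * (2 * L)) + D₀ - (SR + 2 * (s * (2 * L)) + s * k)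
        = D₀ - s * k := by ring
    rw [h1]
    rcases abs_cases ((D₀ : ℤ) - s * k) with h | h <;> linarith

theorem exists_pow_le_card {q : ℕ} (hq : 2 ≤ q) {p : ℤ[X]} (hdeg : 2 ≤ p.natDegree)
    (hlead : 0 < p.leadingCoeff) : ∃ E L₀ : ℕ, 1 ≤ E ∧ ∀ L, L₀ ≤ L →
      q ^ L ≤ ((Finset.range (q ^ (E * L))).filter (fun n => ¬ q ∣ n ∧
        2 * |(digitSum q (p.eval (n : ℤ)).toNat : ℤ) - (digitSum q n : ℤ)| ≤ (q : ℤ) - 1)).card := by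
  obtain ⟨M, hM, hc, hc2⟩ := exists_shift hdeg hlead hq
  set c := taylor (M : ℤ) p with hcdef
  set D := c.natDegree with hD
  set m := q * ((c.coeff 1).toNat + 3) + 1 with hmdef
  have hm : m % q = 1 := by
    rw [hmdef, Nat.mul_add_mod, Nat.mod_eq_of_lt (by omega)]
  have hm3 : (c.coeff 1).toNat + 3 ≤ m :=
    (Nat.le_mul_of_pos_left _ (by omega)).trans (Nat.le_succ _)
  have hcm : c.coeff 1 ≤ (m : ℤ) * (m - 2) := by
    have h1 : c.coeff 1 ≤ (m : ℤ) - 3 := by omega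
    have h2 : (3 : ℤ) ≤ m := by omega
    nlinarith
  obtain ⟨B, A, K, hB, hK, hP⟩ := exists_lift_comp_family hc hc2 (m := m) (by omega) hcm (3 * D + 6)
  set SR := ∑ i ∈ Finset.range B, digitSum q ((shiftedPart M m (3 * D + 6) B 0).coeff i) with hSR
  refine ⟨K * (3 * D + 1) * (B + 2),
    1 + A + (shiftedPart M m (3 * D + 6) B 0).eval 1 + SR, ?_, fun L hL => ?_⟩
  · exact Nat.mul_pos (Nat.mul_pos (by omega) (by omega)) (by omega)
  have hLq : L < q ^ L := Nat.lt_pow_self (by omega)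
  have key := fun w (hw : w ∈ Finset.Icc 1 (q ^ L)) =>
    exists_balanced hq hM hm rfl hB hK hP (L := L) (w := w) (by omega) (by omega) (by omega)
      (by omega) (Finset.mem_Icc.1 hw).1 (Finset.mem_Icc.1 hw).2
  choose! k n hk hn hlt hdvd hbal using key
  calc q ^ L = (Finset.Icc 1 (q ^ L)).card := by simp
    _ ≤ _ := by
      refine Finset.card_le_card_of_injOn n ?_ ?_
      · intro w hw
        simp only [Finset.coe_filter, Finset.mem_range, Set.mem_ofPred_eq]
        exact ⟨hlt w hw, hdvd w hw, hbal w hw⟩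
      · intro w hw w' hw' h
        rw [hn w hw, hn w' hw'] at h
        have h1 := shiftedPart_injective hq (by omega) hm (hk w hw) (hk w' hw') h
        have h2 : 2 ≤ q ^ (2 * L) := hq.trans (Nat.le_self_pow (by omega) q)
        exact Nat.eq_of_mul_eq_mul_right (by omega) h1

end SumOfDigits

theorem general_polynomial (q : ℕ) (hq : 2 ≤ q) (p : Polynomial ℤ)
    (hdeg : 2 ≤ p.natDegree) (hlead : 0 < p.leadingCoeff) :
    ∃ γ : ℝ, 0 < γ ∧ ∃ c : ℝ, 0 < c ∧ ∃ N₀ : ℕ, ∀ N : ℕ, N₀ ≤ N →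
      c * (N : ℝ) ^ γ ≤
        ((Finset.range N).filter (fun n => ¬ q ∣ n ∧
          2 * |((Nat.digits q (p.eval (n : ℤ)).toNat).sum : ℤ)
            - ((Nat.digits q n).sum : ℤ)| ≤ (q : ℤ) - 1)).card := by
  obtain ⟨E, L₀, hE, h⟩ := SumOfDigits.exists_pow_le_card hq hdeg hlead
  exact SumOfDigits.exists_rpow_le hq (fun _ _ hN => Finset.card_le_card
    (Finset.filter_subset_filter _ (Finset.range_mono hN))) hE h
end
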